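/- Suppose 𝔣 is continuous of bounded variation with ∫_𝕋 𝔣(x) dx = 0, and suppose the triple (𝔭, α, x) satisfies ℙ_x(max_{j≤n} ξ_j = ξ_n) → 0 and ℙ_x(min_{j≤n} ξ_j = ξ_n) → 0 as n → ∞. Then E φ(X_n^x) → ∫_𝕋 φ dμ_* for every continuous φ : 𝕋 → ℝ, where μ_* is the unique stationary measure. Consequently, if this condition holds for every x ∈ 𝕋, the random walk with kernel p(x,·) = 𝔭(x)δ_{x+α} + 𝔮(x)δ_{x−α} is mixing. -/

import Mathlib

open MeasureTheory Filter Finset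

noncomputable section

attribute [local instance] Classical.propDecidable

/-- The point `x + j·α` on the circle `𝕋 = ℝ/ℤ`. -/
def pt (α : ℝ) (x : UnitAddCircle) (j : ℤ) : UnitAddCircle :=
  x + (((j : ℝ) * α : ℝ) : UnitAddCircle)

/-- One-step transition probability of the random walk on `ℤ` in the quasi-periodic
environment `(𝔭, α, x)`: from `j` it jumps to `j+1` with probability `𝔭(x+jα)` and to
`j-1` with probability `𝔮(x+jα) = 1-𝔭(x+jα)`. -/
def stepProb (𝔭 : UnitAddCircle → ℝ) (α : ℝ) (x : UnitAddCircle) (j j' : ℤ) : ℝ :=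
  if j' = j + 1 then 𝔭 (pt α x j) else if j' = j - 1 then 1 - 𝔭 (pt α x j) else 0

/-- `ξ` is (a version of) the random walk on `ℤ` in the quasi-periodic environment
`(𝔭, α, x)` started at `start`, defined on the probability space `(Ω, ℙ)`; this is
expressed through its finite-dimensional distributions. -/
def IsQPWalk (𝔭 : UnitAddCircle → ℝ) (α : ℝ) (x : UnitAddCircle) (start : ℤ)
    {Ω : Type} [MeasurableSpace Ω] (ℙ : Measure Ω) (ξ : ℕ → Ω → ℤ) : Prop :=
  IsProbabilityMeasure ℙ ∧ (∀ n, Measurable (ξ n)) ∧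
  ∀ (n : ℕ) (k : ℕ → ℤ),
    ℙ {ω | ∀ i ≤ n, ξ i ω = k i} =
      ENNReal.ofReal ((if k 0 = start then (1 : ℝ) else 0) *
        ∏ i ∈ Finset.range n, stepProb 𝔭 α x (k i) (k (i + 1)))

/-- `𝔣` is continuous, of bounded variation, with `∫_𝕋 𝔣(z) dz = 0`. -/
def ZeroMeanBV (𝔣 : UnitAddCircle → ℝ) : Prop :=
  Continuous 𝔣 ∧ BoundedVariationOn (fun t : ℝ => 𝔣 (t : UnitAddCircle)) (Set.Icc 0 1) ∧
    ∫ z : UnitAddCircle, 𝔣 z = 0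

/-- The function `𝔭 = e^𝔣/(1+e^𝔣)` associated to `𝔣`. -/
def pOf (𝔣 : UnitAddCircle → ℝ) : UnitAddCircle → ℝ :=
  fun z => Real.exp (𝔣 z) / (1 + Real.exp (𝔣 z))

/-- `q` is a close return time of `α`: `q` is the denominator of a rational
approximation with `|α - p/q| < 1/q²`. -/
def CloseReturnTime (α : ℝ) (q : ℕ) : Prop :=
  0 < q ∧ ∃ p : ℤ, |α - (p : ℝ) / (q : ℝ)| < 1 / (q : ℝ) ^ 2

/-- The Markov operator associated to the transition kernel
`p(x,·) = 𝔭(x) δ_{x+α} + (1-𝔭(x)) δ_{x-α}`, acting on Borel measures on the circle: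
`(Pν)(A) = ∫ p(x,A) ν(dx)`. -/
def Pop (𝔭 : UnitAddCircle → ℝ) (α : ℝ) (ν : Measure UnitAddCircle) :
    Measure UnitAddCircle :=
  (ν.withDensity fun z => ENNReal.ofReal (𝔭 z)).map
      (fun z => z + ((α : ℝ) : UnitAddCircle)) +
    (ν.withDensity fun z => ENNReal.ofReal (1 - 𝔭 z)).map
      (fun z => z - ((α : ℝ) : UnitAddCircle))

/-- `μ` is the unique stationary (invariant) probability measure of the kernel
`p(x,·) = 𝔭(x) δ_{x+α} + (1-𝔭(x)) δ_{x-α}`. -/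
def IsUniqueStationary (𝔭 : UnitAddCircle → ℝ) (α : ℝ) (μ : Measure UnitAddCircle) : Prop :=
  IsProbabilityMeasure μ ∧ Pop 𝔭 α μ = μ ∧
    ∀ ν : Measure UnitAddCircle, IsProbabilityMeasure ν → Pop 𝔭 α ν = ν → ν = μ

/-- Condition (1.6): `ℙ_x(max_{j≤n} ξ_j = ξ_n) → 0` and `ℙ_x(min_{j≤n} ξ_j = ξ_n) → 0`
as `n → ∞`. -/
def MaxMinCond {Ω : Type} [MeasurableSpace Ω] (ℙ : Measure Ω) (ξ : ℕ → Ω → ℤ) : Prop :=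
  Tendsto (fun n => (ℙ {ω | ∀ j ≤ n, ξ j ω ≤ ξ n ω}).toReal) atTop (nhds 0) ∧
    Tendsto (fun n => (ℙ {ω | ∀ j ≤ n, ξ n ω ≤ ξ j ω}).toReal) atTop (nhds 0)

/-- The random walk on the circle with transition kernel
`p(x,·) = 𝔭(x) δ_{x+α} + (1-𝔭(x)) δ_{x-α}` is mixing: there is a Borel probability
measure `μ⋆` such that `E φ(X_n^x) → ∫ φ dμ⋆` for every starting point `x` and every
continuous `φ`, where `X_n^x = x + ξ_n α`. -/
def Mixing (𝔭 : UnitAddCircle → ℝ) (α : ℝ) : Prop :=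
  ∃ μstar : Measure UnitAddCircle, IsProbabilityMeasure μstar ∧
    ∀ (x : UnitAddCircle) (Ω : Type) [MeasurableSpace Ω] (ℙ : Measure Ω) (ξ : ℕ → Ω → ℤ),
      IsQPWalk 𝔭 α x 0 ℙ ξ →
      ∀ φ : C(UnitAddCircle, ℝ),
        Tendsto (fun n => ∫ ω, φ (pt α x (ξ n ω)) ∂ℙ) atTop
          (nhds (∫ z, φ z ∂μstar))


theorem qp_lower (α : ℝ) (hα : Irrational α) (D : ℕ) :
    ∃ δ0 : ℝ, 0 < δ0 ∧ ∀ j : ℕ, 0 < j → j ≤ D → ∀ p : ℤ, δ0 ≤ |(j : ℝ) * α - p| := by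
  induction D with
  | zero => exact ⟨1, one_pos, fun j h1 h2 => by omega⟩
  | succ D ih =>
    obtain ⟨d, hd, h⟩ := ih
    have hirr : Irrational (((D + 1 : ℕ) : ℝ) * α) := hα.natCast_mul (by omega)
    refine ⟨min d |((D + 1 : ℕ) : ℝ) * α - round (((D + 1 : ℕ) : ℝ) * α)|, lt_min hd ?_, ?_⟩
    · rw [abs_pos, sub_ne_zero]
      exact hirr.ne_int _
    · intro j hj hjD p
      rcases Nat.lt_or_ge j (D + 1) with h1 | h1
      · exact (min_le_left _ _).trans (h j hj (by omega) p)
      · obtain rfl : j = D + 1 := by omega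
        exact (min_le_right _ _).trans (round_le _ p)

/-- Odd good return times. -/
def QGood (α : ℝ) (Q : ℕ) (P : ℤ) : Prop :=
  Odd Q ∧ IsCoprime (Q : ℤ) P ∧ |(Q : ℝ) * α - P| < 2 / Q

theorem qp_good_exists (α : ℝ) (hα : Irrational α) (ε : ℝ) (hε : 0 < ε) :
    ∃ (Q : ℕ) (P : ℤ), QGood α Q P ∧ |(Q : ℝ) * α - P| < ε := by
  obtain ⟨D, hD⟩ := exists_nat_gt (2 / ε)
  obtain ⟨d0, hd0, hlow⟩ := qp_lower α hα D
  obtain ⟨n, hn⟩ := exists_nat_gt (1 / d0)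
  have hn0 : 0 < n := by
    have : (0 : ℝ) < n := lt_trans (by positivity) hn
    exact_mod_cast this
  obtain ⟨r, hr, hrn⟩ := Real.exists_rat_abs_sub_le_and_den_le α hn0
  set d := r.den with hd
  have hdpos : 0 < d := r.den_pos
  have hdR : (0 : ℝ) < d := by exact_mod_cast hdpos
  have hrd : (r : ℝ) = (r.num : ℝ) / d := by
    rw [hd]; exact_mod_cast (Rat.num_div_den r).symm
  have hnR : (0 : ℝ) < n := by exact_mod_cast hn0
  have key : |(d : ℝ) * α - r.num| ≤ 1 / (n + 1) := by
    have : (d : ℝ) * α - r.num = d * (α - r) := by rw [hrd]; field_simp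
    rw [this, abs_mul, abs_of_pos hdR]
    calc (d : ℝ) * |α - r| ≤ d * (1 / ((n + 1) * d)) := by gcongr
      _ = 1 / (n + 1) := by field_simp
  have hDd : D < d := by
    by_contra hcon
    have h1 := hlow d hdpos (by omega) r.num
    have h2 : (1 : ℝ) / (n + 1) < d0 := by
      rw [div_lt_iff₀ (by positivity)]
      rw [div_lt_iff₀ hd0] at hn
      nlinarith
    linarith
  have hcop : IsCoprime (d : ℤ) r.num := by
    have := r.reduced
    rw [Int.isCoprime_iff_gcd_eq_one, Int.gcd_comm]
    simpa [Int.gcd] using this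
  have hdε : 2 / (d : ℝ) < ε := by
    have : (D : ℝ) < d := by exact_mod_cast hDd
    rw [div_lt_iff₀ hdR]
    rw [div_lt_iff₀ hε] at hD
    nlinarith
  have hnd : (1 : ℝ) / (n + 1) < 1 / d := by
    have : (d : ℝ) ≤ n := by exact_mod_cast hrn
    apply one_div_lt_one_div_of_lt hdR; linarith
  have h12 : (1 : ℝ) / d < 2 / d := by gcongr; norm_num
  rcases Nat.even_or_odd d with hev | hodd
  · -- even
    obtain ⟨u, v, huv⟩ := hcop
    -- u d + v num = 1
    set q' : ℤ := v % d with hq'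
    have hq0 : 0 ≤ q' := Int.emod_nonneg _ (by omega)
    have hqd : q' < d := Int.emod_lt_of_pos _ (by omega)
    obtain ⟨p', hp'⟩ : ∃ p' : ℤ, q' * r.num = 1 + d * p' := by
      refine ⟨-u - (v / d) * r.num, ?_⟩
      have : v = d * (v / d) + q' := (Int.mul_ediv_add_emod v d).symm
      have h2 : q' = v - d * (v / d) := by omega
      rw [h2]; linarith [huv, mul_comm u (d:ℤ)]
    have hq1 : Odd q' := by
      have h3 : Odd (q' * r.num) := by
        rw [hp']
        have : Even ((d : ℤ) * p') := ((Int.even_coe_nat d).2 hev).mul_right _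
        exact odd_one.add_even this
      exact (Int.odd_mul.1 h3).1
    obtain ⟨Q, hQ⟩ := Int.eq_ofNat_of_zero_le hq0
    have hQodd : Odd Q := by rw [hQ] at hq1; exact_mod_cast hq1
    have hQpos : 0 < Q := hQodd.pos
    have hQd : Q < d := by omega
    have hQR : (0 : ℝ) < Q := by exact_mod_cast hQpos
    have hQdR : (Q : ℝ) < d := by exact_mod_cast hQd
    have hrel : (Q : ℝ) * r.num = 1 + d * p' := by
      rw [hQ] at hp'; exact_mod_cast hp'
    have hbound : |(Q : ℝ) * α - p'| < 2 / d := by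
      have e : (Q : ℝ) * α - p' = (Q / d) * ((d : ℝ) * α - r.num) + 1 / d := by
        field_simp
        linarith
      rw [e]
      calc |(Q / d : ℝ) * ((d : ℝ) * α - r.num) + 1 / d|
          ≤ |(Q / d : ℝ) * ((d : ℝ) * α - r.num)| + |1 / (d : ℝ)| := abs_add_le _ _
        _ = (Q / d : ℝ) * |(d : ℝ) * α - r.num| + 1 / d := by
            rw [abs_mul, abs_of_pos (by positivity : (0 : ℝ) < Q / d),
              abs_of_pos (by positivity : (0 : ℝ) < 1 / d)]
        _ < 1 / d + 1 / d := by
            have : (Q / d : ℝ) ≤ 1 := (div_le_one hdR).2 hQdR.le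
            have : (Q / d : ℝ) * |(d : ℝ) * α - r.num| ≤ 1 * |(d : ℝ) * α - r.num| := by gcongr
            linarith
        _ = 2 / d := by ring
    refine ⟨Q, p', ⟨hQodd, ⟨r.num, -d, ?_⟩, ?_⟩, hbound.trans hdε⟩
    · rw [hQ] at hp'
      have : (Q : ℤ) * r.num = 1 + d * p' := hp'
      linarith
    · refine hbound.trans_le ?_
      gcongr
  · exact ⟨d, r.num, ⟨hodd, hcop, by linarith⟩, by linarith⟩

theorem qp_good_frequently (α : ℝ) (hα : Irrational α) (N : ℕ) :
    ∃ (Q : ℕ) (P : ℤ), QGood α Q P ∧ N ≤ Q := by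
  obtain ⟨d0, hd0, hlow⟩ := qp_lower α hα N
  obtain ⟨Q, P, h1, h2⟩ := qp_good_exists α hα d0 hd0
  refine ⟨Q, P, h1, ?_⟩
  by_contra hcon
  have := hlow Q h1.1.pos (by omega) P
  linarith

theorem qp_V (𝔣 : UnitAddCircle → ℝ)
    (hbv : BoundedVariationOn (fun t : ℝ => 𝔣 (t : UnitAddCircle)) (Set.Icc 0 1)) :
    ∃ (V : ℝ → ℝ) (W : ℝ), (∀ t, V (t + 1) = V t + W) ∧
      ∀ s t : ℝ, s ≤ t → |𝔣 (t : UnitAddCircle) - 𝔣 (s : UnitAddCircle)| ≤ V t - V s := by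
  set F : ℝ → ℝ := fun t : ℝ => 𝔣 (t : UnitAddCircle) with hF
  have hl := hbv.locallyBoundedVariationOn
  set v : ℝ → ℝ := variationOnFromTo F (Set.Icc 0 1) 0 with hv
  have h0 : (0 : ℝ) ∈ Set.Icc (0 : ℝ) 1 := by simp
  have h1 : (1 : ℝ) ∈ Set.Icc (0 : ℝ) 1 := by simp
  have key : ∀ s t : ℝ, s ∈ Set.Icc (0 : ℝ) 1 → t ∈ Set.Icc (0 : ℝ) 1 → s ≤ t →
      |F t - F s| ≤ v t - v s := fun s t hs ht hst =>
    variationOnFromTo.abs_sub_le_sub_of_le hl h0 hs ht hst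
  have hv0 : v 0 = 0 := variationOnFromTo.self F _ 0
  have hv1 : 0 ≤ v 1 := by
    have := key 0 1 h0 h1 zero_le_one
    have h2 := abs_nonneg (F 1 - F 0)
    linarith
  have hper : ∀ (t : ℝ), F t = F (Int.fract t) := by
    intro t
    have : ((Int.fract t : ℝ) : UnitAddCircle) = (t : UnitAddCircle) := by
      rw [← Int.self_sub_floor, AddCircle.coe_sub]
      have : ((⌊t⌋ : ℝ) : UnitAddCircle) = 0 := by
        rw [AddCircle.coe_eq_zero_iff]
        exact ⟨⌊t⌋, by simp⟩
      rw [this, sub_zero]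
    simp only [hF, this]
  have h01 : F 1 = F 0 := by
    have := hper 1
    simpa using this
  have hfr : ∀ t : ℝ, Int.fract t ∈ Set.Icc (0 : ℝ) 1 := fun t =>
    ⟨Int.fract_nonneg t, (Int.fract_lt_one t).le⟩
  refine ⟨fun t => v (Int.fract t) + ⌊t⌋ * v 1, v 1, ?_, ?_⟩
  · intro t
    simp only [Int.fract_add_one, Int.floor_add_one]
    push_cast; ring
  · intro s t hst
    change |F t - F s| ≤ _
    rw [hper t, hper s]
    rcases (Int.floor_mono hst).eq_or_lt with he | hlt
    · have hle : Int.fract s ≤ Int.fract t := by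
        rw [← Int.self_sub_floor, ← Int.self_sub_floor, he]; linarith
      have := key _ _ (hfr s) (hfr t) hle
      simp only [he]; linarith
    · have a1 := key _ _ (hfr s) h1 (hfr s).2
      have a2 := key _ _ h0 (hfr t) (hfr t).1
      have a3 : (⌊s⌋ : ℝ) + 1 ≤ ⌊t⌋ := by exact_mod_cast hlt
      rw [h01] at a1
      rw [abs_le] at a1 a2 ⊢
      simp only
      constructor <;> nlinarith

theorem qp_DK (α : ℝ) (𝔣 : UnitAddCircle → ℝ) (hc : Continuous 𝔣)
    (hint : ∫ z : UnitAddCircle, 𝔣 z = 0) (V : ℝ → ℝ) (W : ℝ)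
    (hV : ∀ t, V (t + 1) = V t + W)
    (hVF : ∀ s t : ℝ, s ≤ t → |𝔣 (t : UnitAddCircle) - 𝔣 (s : UnitAddCircle)| ≤ V t - V s)
    (Q : ℕ) (P : ℤ) (hQ : QGood α Q P) (y : ℝ) :
    |∑ j ∈ Finset.range Q, 𝔣 ((y + j * α : ℝ) : UnitAddCircle)| ≤ 5 * W := by
  obtain ⟨hodd, hcop, happ⟩ := hQ
  have hQ0 : 0 < Q := hodd.pos
  have hQR : (0 : ℝ) < Q := by exact_mod_cast hQ0
  set F : ℝ → ℝ := fun t : ℝ => 𝔣 (t : UnitAddCircle) with hF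
  have hFc : Continuous F := hc.comp (AddCircle.continuous_mk' 1)
  have hFper : ∀ (t : ℝ) (n : ℤ), F (t + n) = F t := by
    intro t n
    have : ((n : ℝ) : UnitAddCircle) = 0 := by
      rw [AddCircle.coe_eq_zero_iff]
      exact ⟨n, by simp⟩
    simp only [hF, AddCircle.coe_add, this, add_zero]
  -- osc bound
  have hosc : ∀ a b s t : ℝ, a ≤ s → s ≤ b → a ≤ t → t ≤ b → |F s - F t| ≤ V b - V a := by
    intro a b s t h1 h2 h3 h4
    have mono : ∀ u w : ℝ, u ≤ w → V u ≤ V w := fun u w h => by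
      have := (abs_nonneg _).trans (hVF u w h); linarith
    rcases le_total s t with h | h
    · rw [abs_sub_comm]
      have := hVF s t h
      have := mono _ _ h1; have := mono _ _ h4
      simp only [hF]; linarith
    · have := hVF t s h
      have := mono _ _ h3; have := mono _ _ h2
      simp only [hF]; linarith
  set κ : ℕ → ℕ := fun j => ((j * P) % (Q : ℤ)).toNat with hκ
  have hκ' : ∀ j, ((κ j : ℕ) : ℤ) = (j * P) % (Q : ℤ) := fun j =>
    Int.toNat_of_nonneg (Int.emod_nonneg _ (by omega))
  have hκlt : ∀ j, κ j < Q := by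
    intro j
    have h1 := hκ' j
    have h2 : (j * P) % (Q : ℤ) < Q := Int.emod_lt_of_pos _ (by omega)
    omega
  have hinj : Set.InjOn κ (Finset.range Q : Set ℕ) := by
    intro i hi j hj hij
    simp only [Finset.coe_range, Set.mem_Iio] at hi hj
    have h1 : ((i : ℤ) * P) % (Q : ℤ) = (j * P) % (Q : ℤ) := by rw [← hκ', ← hκ', hij]
    have h2 : (Q : ℤ) ∣ (i * P - j * P) := Int.ModEq.dvd (Int.ModEq.symm h1)
    rw [← sub_mul] at h2
    have h3 := hcop.dvd_of_dvd_mul_right h2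
    have h4 : ((i : ℤ) - j) = 0 := by
      apply Int.eq_zero_of_abs_lt_dvd h3
      rw [abs_lt]; omega
    omega
  have himg : (Finset.range Q).image κ = Finset.range Q := by
    apply Finset.eq_of_subset_of_card_le
    · intro k hk
      obtain ⟨j, -, rfl⟩ := Finset.mem_image.1 hk
      exact Finset.mem_range.2 (hκlt j)
    · rw [Finset.card_image_of_injOn hinj]
  have hsumκ : ∀ g : ℕ → ℝ, ∑ j ∈ Finset.range Q, g (κ j) = ∑ k ∈ Finset.range Q, g k := by
    intro g
    conv_rhs => rw [← himg]
    rw [Finset.sum_image hinj]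
  set I : ℕ → ℝ := fun k => ∫ t in (y + (k : ℝ) / Q)..(y + ((k + 1 : ℕ) : ℝ) / Q), F t with hI
  have hIsum : ∑ k ∈ Finset.range Q, I k = 0 := by
    have := intervalIntegral.sum_integral_adjacent_intervals (f := F) (μ := volume)
      (a := fun k : ℕ => y + (k : ℝ) / Q) (n := Q)
      (fun k _ => hFc.intervalIntegrable _ _)
    rw [hI, this]
    have e : y + ((Q : ℕ) : ℝ) / Q = y + 1 := by field_simp
    simp only [e, Nat.cast_zero, zero_div, add_zero]
    rw [UnitAddCircle.intervalIntegral_preimage y 𝔣, hint]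
  set u : ℕ → ℝ := fun k => V (y + ((k : ℝ) - 2) / Q) with hu
  have huQ : ∀ k, u (k + Q) = u k + W := by
    intro k
    simp only [hu]
    rw [← hV]; congr 1; push_cast; field_simp; ring
  have hterm : ∀ j ∈ Finset.range Q, |F (y + j * α) - Q * I (κ j)| ≤ u (κ j + 5) - u (κ j) := by
    intro j hj
    have hjQ : (j : ℝ) < Q := by exact_mod_cast Finset.mem_range.1 hj
    obtain ⟨m, hm⟩ : ∃ m : ℤ, (j : ℤ) * P = κ j + Q * m :=
      ⟨(j * P) / Q, by rw [hκ']; exact (Int.emod_add_mul_ediv _ _).symm⟩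
    have hmR : (j : ℝ) * P = κ j + Q * m := by exact_mod_cast hm
    set e : ℝ := j * α - j * P / Q with he
    have hee : |e| ≤ 2 / Q := by
      have : e = (j / Q) * (Q * α - P) := by rw [he]; field_simp
      rw [this, abs_mul, abs_of_nonneg (by positivity)]
      calc (j / Q : ℝ) * |Q * α - P| ≤ 1 * (2 / Q) := by
            apply mul_le_mul _ happ.le (abs_nonneg _) zero_le_one
            rw [div_le_one hQR]; exact hjQ.le
        _ = 2 / Q := one_mul _
    have hFj : F (y + j * α) = F (y + κ j / Q + e) := by
      rw [← hFper (y + κ j / Q + e) m]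
      congr 1
      rw [he, hmR]; field_simp; ring
    rw [hFj]
    set s := y + κ j / Q + e
    have hee' := abs_le.1 hee
    have hab : y + (κ j : ℝ) / Q ≤ y + ((κ j + 1 : ℕ) : ℝ) / Q := by
      gcongr; omega
    have hC : (F s - Q * I (κ j)) =
        Q * ∫ t in (y + (κ j : ℝ) / Q)..(y + ((κ j + 1 : ℕ) : ℝ) / Q), (F s - F t) := by
      rw [intervalIntegral.integral_sub (by simp) (hFc.intervalIntegrable _ _)]
      simp only [intervalIntegral.integral_const, smul_eq_mul, hI]
      push_cast
      field_simp
      ring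
    rw [hC, abs_mul, abs_of_pos hQR]
    have hb : ‖∫ t in (y + (κ j : ℝ) / Q)..(y + ((κ j + 1 : ℕ) : ℝ) / Q), (F s - F t)‖ ≤
        (u (κ j + 5) - u (κ j)) *
          |y + ((κ j + 1 : ℕ) : ℝ) / Q - (y + (κ j : ℝ) / Q)| := by
      apply intervalIntegral.norm_integral_le_of_norm_le_const
      intro t ht
      rw [Set.uIoc_of_le hab] at ht
      rw [Real.norm_eq_abs]
      have q1 : (0:ℝ) < 1 / Q := by positivity
      have q2 : (2:ℝ) / Q = 2 * (1 / Q) := by ring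
      have e1 : y + (((κ j + 5 : ℕ) : ℝ) - 2) / Q = y + (κ j : ℝ) / Q + 3 * (1 / Q) := by
        push_cast; ring
      have e2 : y + (((κ j : ℕ) : ℝ) - 2) / Q = y + (κ j : ℝ) / Q - 2 * (1 / Q) := by ring
      have e3 : y + ((κ j + 1 : ℕ) : ℝ) / Q = y + (κ j : ℝ) / Q + 1 / Q := by push_cast; ring
      rw [e3] at ht
      simp only [hu]
      rw [e1, e2]
      apply hosc
      · simp only [s]; linarith
      · simp only [s]; linarith
      · linarith [ht.1]
      · linarith [ht.2]
    rw [Real.norm_eq_abs] at hb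
    have : |y + ((κ j + 1 : ℕ) : ℝ) / Q - (y + (κ j : ℝ) / Q)| = 1 / Q := by
      rw [abs_of_nonneg (by linarith)]; push_cast; ring
    rw [this] at hb
    calc _ ≤ (Q : ℝ) * ((u (κ j + 5) - u (κ j)) * (1 / Q)) := by gcongr
      _ = _ := by field_simp
  have htel : ∀ i : ℕ, ∑ k ∈ Finset.range Q, (u (k + (i + 1)) - u (k + i)) = W := by
    intro i
    have := Finset.sum_range_sub (fun k => u (k + i)) Q
    simp only [zero_add] at this
    rw [← add_comm i Q, huQ i] at this
    rw [add_sub_cancel_left] at this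
    rw [← this]
    apply Finset.sum_congr rfl
    intro k _
    congr 2; ring
  have hfive : ∑ k ∈ Finset.range Q, (u (k + 5) - u k) = 5 * W := by
    have h0 := htel 0; have h1 := htel 1; have h2 := htel 2; have h3 := htel 3; have h4 := htel 4
    have : ∑ k ∈ Finset.range Q, (u (k + 5) - u k) =
        ∑ k ∈ Finset.range Q, (u (k + (0 + 1)) - u (k + 0)) +
        ∑ k ∈ Finset.range Q, (u (k + (1 + 1)) - u (k + 1)) +
        ∑ k ∈ Finset.range Q, (u (k + (2 + 1)) - u (k + 2)) +
        ∑ k ∈ Finset.range Q, (u (k + (3 + 1)) - u (k + 3)) +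
        ∑ k ∈ Finset.range Q, (u (k + (4 + 1)) - u (k + 4)) := by
      simp only [← Finset.sum_add_distrib]
      apply Finset.sum_congr rfl
      intro k _
      norm_num
    rw [this, h0, h1, h2, h3, h4]; ring
  have hkey : ∑ j ∈ Finset.range Q, F (y + j * α) =
      ∑ j ∈ Finset.range Q, (F (y + j * α) - Q * I (κ j)) := by
    rw [Finset.sum_sub_distrib, hsumκ (fun k => Q * I k), ← Finset.mul_sum, hIsum]; simp
  change |∑ j ∈ Finset.range Q, F (y + j * α)| ≤ _
  rw [hkey]
  calc _ ≤ ∑ j ∈ Finset.range Q, |F (y + j * α) - Q * I (κ j)| := Finset.abs_sum_le_sum_abs _ _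
    _ ≤ ∑ j ∈ Finset.range Q, (u (κ j + 5) - u (κ j)) := Finset.sum_le_sum hterm
    _ = _ := by rw [hsumκ (fun k => u (k + 5) - u k), hfive]

theorem qp_seq (δ : ℝ) (hδ : 0 < δ) (hδ1 : δ ≤ 1) (m : ℕ) : ∀ η : ℝ, 0 < η → ∃ ε : ℝ, 0 < ε ∧
    ∀ (c : ℝ) (y : ℕ → ℝ), (∀ i < m, y (i + 1) ≤ δ * y i + (1 - δ) * (c + ε)) → c - ε ≤ y m →
      ∀ i ≤ m, c - η ≤ y i := by
  induction m with
  | zero =>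
    intro η hη
    refine ⟨η, hη, fun c y _ h i hi => ?_⟩
    obtain rfl : i = 0 := by omega
    exact h
  | succ m ih =>
    intro η hη
    obtain ⟨ε', hε', h⟩ := ih η hη
    refine ⟨min (δ * ε' / 2) (min ε' η), by positivity, ?_⟩
    set ε := min (δ * ε' / 2) (min ε' η)
    have h1 : ε ≤ δ * ε' / 2 := min_le_left _ _
    have h2 : ε ≤ ε' := (min_le_right _ _).trans (min_le_left _ _)
    have h3 : ε ≤ η := (min_le_right _ _).trans (min_le_right _ _)
    have h0 : 0 < ε := by positivity
    intro c y hy hm i hi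
    rcases Nat.lt_or_ge i (m + 1) with hlt | hge
    · refine h c y (fun j hj => (hy j (by omega)).trans ?_) ?_ i (by omega)
      · have : (1 - δ) * (c + ε) ≤ (1 - δ) * (c + ε') := by
          apply mul_le_mul_of_nonneg_left _ (by linarith)
          linarith
        linarith
      · have h5 := hy m (by omega)
        have h6 : δ * (c - ε') ≤ δ * y m := by nlinarith
        exact le_of_mul_le_mul_left h6 hδ
    · obtain rfl : i = m + 1 := by omega
      linarith

theorem qp_lemmaA {X : Type} [Nonempty X] (φ : ℕ → X → ℝ) (B δ : ℝ) (hδ : 0 < δ) (hδ1 : δ ≤ 1)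
    (hB : ∀ n x, |φ n x| ≤ B)
    (H : ∀ n C, (∀ x, φ n x - φ (n + 1) x ≤ C) →
      ∀ x, φ (n + 1) x - φ (n + 2) x ≤ δ * (φ n x - φ (n + 1) x) + (1 - δ) * C) :
    ∀ ε : ℝ, 0 < ε → ∃ N, ∀ n ≥ N, ∀ x, φ n x - φ (n + 1) x ≤ ε := by
  set g : ℕ → X → ℝ := fun n x => φ n x - φ (n + 1) x with hg
  have hgB : ∀ n x, |g n x| ≤ 2 * B := by
    intro n x
    have h1 := abs_le.1 (hB n x)
    have h2 := abs_le.1 (hB (n + 1) x)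
    simp only [hg]
    rw [abs_le]; constructor <;> linarith
  have hbdd : ∀ n, BddAbove (Set.range (g n)) := by
    intro n
    refine ⟨2 * B, ?_⟩
    rintro _ ⟨x, rfl⟩
    exact (abs_le.1 (hgB n x)).2
  set M : ℕ → ℝ := fun n => ⨆ x, g n x with hM
  have hle : ∀ n x, g n x ≤ M n := fun n x => le_ciSup (hbdd n) x
  have hanti : Antitone M := by
    apply antitone_nat_of_succ_le
    intro n
    apply ciSup_le
    intro x
    have h1 := H n (M n) (hle n) x
    have h2 : δ * g n x ≤ δ * M n := mul_le_mul_of_nonneg_left (hle n x) hδ.le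
    calc g (n + 1) x ≤ δ * g n x + (1 - δ) * M n := h1
      _ ≤ M n := by linarith
  have hbelow : BddBelow (Set.range M) := by
    refine ⟨-(2 * B), ?_⟩
    rintro _ ⟨n, rfl⟩
    obtain ⟨x⟩ := ‹Nonempty X›
    exact (abs_le.1 (hgB n x)).1.trans (hle n x)
  have hlim := tendsto_atTop_ciInf hanti hbelow
  set c := ⨅ n, M n with hc
  have hcM : ∀ n, c ≤ M n := fun n => ciInf_le hbelow n
  have hc0 : c ≤ 0 := by
    by_contra hcon
    push Not at hcon
    obtain ⟨m, hm⟩ := exists_nat_gt (2 * B / (c / 2))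
    rw [div_lt_iff₀ (by positivity)] at hm
    obtain ⟨ε, hε, hseq⟩ := qp_seq δ hδ hδ1 m (c / 2) (by positivity)
    obtain ⟨N, hN⟩ := ((hlim.eventually (gt_mem_nhds (show c < c + ε by linarith)))).exists
    have hNn : ∀ n ≥ N, ∀ x, g n x ≤ c + ε := fun n hn x =>
      (hle n x).trans ((hanti hn).trans hN.le)
    obtain ⟨x, hx⟩ : ∃ x, M (N + m) - ε < g (N + m) x := by
      apply exists_lt_of_lt_ciSup
      linarith
    have hres := hseq c (fun i => g (N + i) x)
      (fun i _ => H (N + i) (c + ε) (hNn (N + i) (by omega)) x)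
      (by have := hcM (N + m); change c - ε ≤ g (N + m) x; linarith)
    have hsum : ∑ i ∈ Finset.range m, g (N + i) x = φ N x - φ (N + m) x := by
      have := Finset.sum_range_sub' (fun i => φ (N + i) x) m
      simpa [hg, add_assoc] using this
    have hlow : (m : ℝ) * (c / 2) ≤ ∑ i ∈ Finset.range m, g (N + i) x := by
      have := Finset.card_nsmul_le_sum (Finset.range m) (fun i => g (N + i) x) (c / 2)
        (fun i hi => by
          have := hres i (Finset.mem_range.1 hi).le
          linarith)
      simpa using this
    have h1 := abs_le.1 (hB N x)
    have h2 := abs_le.1 (hB (N + m) x)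
    rw [hsum] at hlow
    linarith
  intro ε hε
  obtain ⟨N, hN⟩ := ((hlim.eventually (gt_mem_nhds (show c < c + ε by linarith)))).exists
  exact ⟨N, fun n hn x => (hle n x).trans ((hanti hn).trans (by linarith))⟩

/-- dual Markov operator on functions -/
def Aop (p : UnitAddCircle → ℝ) (α : ℝ) (φ : UnitAddCircle → ℝ) : UnitAddCircle → ℝ :=
  fun z => p z * φ (z + (α : UnitAddCircle)) + (1 - p z) * φ (z - (α : UnitAddCircle))

theorem Aop_bound (p : UnitAddCircle → ℝ) (α : ℝ) (hp : ∀ z, 0 ≤ p z ∧ p z ≤ 1)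
    (φ : UnitAddCircle → ℝ) (B : ℝ) (h : ∀ z, |φ z| ≤ B) (z) : |Aop p α φ z| ≤ B := by
  have h1 := abs_le.1 (h (z + (α : UnitAddCircle)))
  have h2 := abs_le.1 (h (z - (α : UnitAddCircle)))
  have := hp z
  simp only [Aop]
  rw [abs_le]
  constructor <;> nlinarith

theorem Aop_iter_bound (p : UnitAddCircle → ℝ) (α : ℝ) (hp : ∀ z, 0 ≤ p z ∧ p z ≤ 1)
    (φ : UnitAddCircle → ℝ) (B : ℝ) (h : ∀ z, |φ z| ≤ B) (n : ℕ) :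
    ∀ z, |((Aop p α)^[n] φ) z| ≤ B := by
  induction n with
  | zero => exact h
  | succ n ih =>
    rw [Function.iterate_succ_apply']
    exact Aop_bound p α hp _ B ih

theorem Aop_sub (p : UnitAddCircle → ℝ) (α : ℝ) (φ ψ : UnitAddCircle → ℝ) (z) :
    Aop p α φ z - Aop p α ψ z = Aop p α (φ - ψ) z := by
  simp only [Aop, Pi.sub_apply]; ring

theorem Aop2_le (p : UnitAddCircle → ℝ) (α : ℝ) (d : ℝ) (hd : 0 < d)
    (hp : ∀ z, d ≤ p z ∧ p z ≤ 1 - d) (g : UnitAddCircle → ℝ) (C : ℝ) (hg : ∀ z, g z ≤ C) (z) :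
    Aop p α (Aop p α g) z ≤ d ^ 2 * g z + (1 - d ^ 2) * C := by
  set a : UnitAddCircle := (α : UnitAddCircle)
  have e1 : z + a - a = z := by abel
  have e2 : z - a + a = z := by abel
  have h1 := hp z
  have h2 := hp (z + a)
  have h3 := hp (z - a)
  have g0 := hg z
  have g1 := hg (z + a + a)
  have g2 := hg (z - a - a)
  change p z * (p (z + a) * g (z + a + a) + (1 - p (z + a)) * g (z + a - a)) +
    (1 - p z) * (p (z - a) * g (z - a + a) + (1 - p (z - a)) * g (z - a - a)) ≤ _
  rw [e1, e2]
  have b1 : p z * (p (z + a)) * g (z + a + a) ≤ p z * (p (z + a)) * C :=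
    mul_le_mul_of_nonneg_left g1 (mul_nonneg (by linarith) (by linarith))
  have b2 : (1 - p z) * (1 - p (z - a)) * g (z - a - a) ≤ (1 - p z) * (1 - p (z - a)) * C :=
    mul_le_mul_of_nonneg_left g2 (mul_nonneg (by linarith) (by linarith))
  have w1 : d ^ 2 ≤ p z * (1 - p (z + a)) := by nlinarith
  have w2 : 0 ≤ (1 - p z) * p (z - a) := mul_nonneg (by linarith) (by linarith)
  have b3 : (p z * (1 - p (z + a)) + (1 - p z) * p (z - a) - d ^ 2) * (g z - C) ≤ 0 :=
    mul_nonpos_of_nonneg_of_nonpos (by linarith) (by linarith)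
  nlinarith

theorem Aop_asymp (p : UnitAddCircle → ℝ) (α : ℝ) (d : ℝ) (hd : 0 < d)
    (hp : ∀ z, d ≤ p z ∧ p z ≤ 1 - d) (φ : UnitAddCircle → ℝ) (B : ℝ) (h : ∀ z, |φ z| ≤ B)
    (x : UnitAddCircle) :
    Tendsto (fun n => ((Aop p α)^[n] φ) x - ((Aop p α)^[n + 2] φ) x) atTop (nhds 0) := by
  have hp' : ∀ z, 0 ≤ p z ∧ p z ≤ 1 := fun z => ⟨by linarith [hp z], by linarith [hp z]⟩
  have hd1 : d ≤ 1 := by linarith [hp 0]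
  have main : ∀ φ : UnitAddCircle → ℝ, (∀ z, |φ z| ≤ B) → ∀ ε : ℝ, 0 < ε → ∃ N, ∀ n ≥ N, ∀ x,
      ((Aop p α)^[2 * n] φ) x - ((Aop p α)^[2 * n + 2] φ) x ≤ ε := by
    intro φ h
    refine qp_lemmaA (fun n => (Aop p α)^[2 * n] φ) B (d ^ 2) (by positivity)
      (by nlinarith) (fun n x => Aop_iter_bound p α hp' φ B h _ x) ?_
    intro n C hC x
    have key := Aop2_le p α d hd hp ((Aop p α)^[2 * n] φ - (Aop p α)^[2 * (n + 1)] φ) C hC x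
    have e : Aop p α (Aop p α ((Aop p α)^[2 * n] φ - (Aop p α)^[2 * (n + 1)] φ)) x =
        ((Aop p α)^[2 * (n + 1)] φ) x - ((Aop p α)^[2 * (n + 2)] φ) x := by
      have e1 : Aop p α ((Aop p α)^[2 * n] φ - (Aop p α)^[2 * (n + 1)] φ) =
          (Aop p α)^[2 * n + 1] φ - (Aop p α)^[2 * n + 3] φ := by
        funext z
        rw [← Aop_sub, ← Function.iterate_succ_apply' (Aop p α),
          ← Function.iterate_succ_apply' (Aop p α)]
        rfl
      rw [e1, ← Aop_sub, ← Function.iterate_succ_apply' (Aop p α),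
          ← Function.iterate_succ_apply' (Aop p α)]
      rfl
    rw [e] at key
    exact key
  have neg : ∀ (n : ℕ) (φ : UnitAddCircle → ℝ), (Aop p α)^[n] (-φ) = -((Aop p α)^[n] φ) := by
    intro n
    induction n with
    | zero => intro φ; rfl
    | succ n ih =>
      intro φ
      rw [Function.iterate_succ_apply, Function.iterate_succ_apply, ← ih]
      congr 1
      funext z
      simp only [Aop, Pi.neg_apply]; ring
  have h1 : ∀ z, |(Aop p α φ) z| ≤ B := Aop_bound p α hp' φ B h
  rw [Metric.tendsto_atTop]
  intro ε hε
  have hε2 : 0 < ε / 2 := by positivity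
  obtain ⟨N1, H1⟩ := main φ h _ hε2
  obtain ⟨N2, H2⟩ := main (-φ) (fun z => by simpa using h z) _ hε2
  obtain ⟨N3, H3⟩ := main (Aop p α φ) h1 _ hε2
  obtain ⟨N4, H4⟩ := main (-(Aop p α φ)) (fun z => by simpa using h1 z) _ hε2
  refine ⟨2 * (N1 + N2 + N3 + N4) + 1, fun n hn => ?_⟩
  rw [Real.dist_eq, sub_zero]
  refine lt_of_le_of_lt ?_ (half_lt_self hε)
  rw [abs_le]
  rcases Nat.even_or_odd' n with ⟨k, rfl | rfl⟩
  · have a1 := H1 k (by omega) x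
    have a2 := H2 k (by omega) x
    rw [neg, neg] at a2
    simp only [Pi.neg_apply] at a2
    constructor <;> linarith
  · have a1 := H3 k (by omega) x
    have a2 := H4 k (by omega) x
    rw [neg, neg] at a2
    simp only [Pi.neg_apply] at a2
    rw [← Function.iterate_succ_apply, ← Function.iterate_succ_apply] at a1 a2
    constructor
    · have : 2 * k + 1 + 2 = (2 * k + 2).succ := by omega
      rw [this]; linarith
    · have : 2 * k + 1 + 2 = (2 * k + 2).succ := by omega
      rw [this]; linarith

/-- Birkhoff sums -/
def BS (f : UnitAddCircle → ℝ) (a : UnitAddCircle) (n : ℕ) (z : UnitAddCircle) : ℝ :=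
  ∑ j ∈ Finset.range n, f (z + j • a)

theorem BS_succ (f : UnitAddCircle → ℝ) (a : UnitAddCircle) (n : ℕ) (z : UnitAddCircle) :
    BS f a (n + 1) z = f z + BS f a n (z + a) := by
  unfold BS
  rw [Finset.sum_range_succ']
  rw [add_comm]
  congr 1
  · simp
  · apply Finset.sum_congr rfl
    intro j _
    congr 1
    rw [succ_nsmul]; abel

theorem BS_cont (f : UnitAddCircle → ℝ) (hf : Continuous f) (a : UnitAddCircle) (n : ℕ) :
    Continuous (BS f a n) := by
  unfold BS
  fun_prop

theorem coe_nsmul_lift (α y : ℝ) (j : ℕ) :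
    ((y + j * α : ℝ) : UnitAddCircle) = (y : UnitAddCircle) + j • (α : UnitAddCircle) := by
  rw [AddCircle.coe_add, ← nsmul_eq_mul, AddCircle.coe_nsmul]

theorem BS_DK (α : ℝ) (f : UnitAddCircle → ℝ) (hf : ZeroMeanBV f) :
    ∃ C : ℝ, ∀ (Q : ℕ) (P : ℤ), QGood α Q P → ∀ z, |BS f (α : UnitAddCircle) Q z| ≤ C := by
  obtain ⟨hc, hbv, hint⟩ := hf
  obtain ⟨V, W, hV, hVF⟩ := qp_V f hbv
  refine ⟨5 * W, fun Q P hQ z => ?_⟩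
  obtain ⟨y, rfl⟩ := QuotientAddGroup.mk_surjective z
  have := qp_DK α f hc hint V W hV hVF Q P hQ y
  simp only [coe_nsmul_lift] at this
  exact this

theorem integ_bdd {X : Type} [MeasurableSpace X] (m : Measure X) [IsFiniteMeasure m] (ψ : X → ℝ)
    (hψ : Measurable ψ) (B : ℝ) (hB : ∀ z, |ψ z| ≤ B) : Integrable ψ m :=
  Integrable.of_bound hψ.aestronglyMeasurable B (Filter.Eventually.of_forall hB)

theorem cont_bdd (f : UnitAddCircle → ℝ) (hf : Continuous f) : ∃ B : ℝ, 0 ≤ B ∧ ∀ z, |f z| ≤ B := by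
  obtain ⟨x, -, hx⟩ := isCompact_univ.exists_isMaxOn (Set.univ_nonempty (α := UnitAddCircle))
    (continuous_abs.comp hf).continuousOn
  exact ⟨|f x|, abs_nonneg _, fun z => hx (Set.mem_univ z)⟩

theorem integ_cont (m : Measure UnitAddCircle) [IsFiniteMeasure m] (ψ : UnitAddCircle → ℝ)
    (hψ : Continuous ψ) : Integrable ψ m := by
  obtain ⟨B, -, hB⟩ := cont_bdd ψ hψ
  exact integ_bdd m ψ hψ.measurable B hB

theorem meas_ext (μ ν : Measure UnitAddCircle) [IsFiniteMeasure μ] [IsFiniteMeasure ν]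
    (h : ∀ φ : UnitAddCircle → ℝ, Continuous φ → ∫ z, φ z ∂μ = ∫ z, φ z ∂ν) : μ = ν :=
  ext_of_forall_integral_eq_of_IsFiniteMeasure fun φ => h φ φ.continuous

theorem ultra_lim {ι : Type} (M : ι → Measure UnitAddCircle) (hM : ∀ i, IsProbabilityMeasure (M i))
    (U : Ultrafilter ι) : ∃ m : Measure UnitAddCircle, IsProbabilityMeasure m ∧
      ∀ φ : UnitAddCircle → ℝ, Continuous φ →
        Tendsto (fun i => ∫ z, φ z ∂(M i)) U (nhds (∫ z, φ z ∂m)) := by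
  let Ms : ι → ProbabilityMeasure UnitAddCircle := fun i => ⟨M i, hM i⟩
  obtain ⟨m, -, hm⟩ := isCompact_univ.ultrafilter_le_nhds (U.map Ms) (by simp)
  have h2 : Tendsto Ms U (nhds m) := hm
  rw [ProbabilityMeasure.tendsto_iff_forall_integral_tendsto] at h2
  exact ⟨m, m.2, fun φ hφ => h2 (BoundedContinuousFunction.mkOfCompact ⟨φ, hφ⟩)⟩

theorem conformal_exists (α : ℝ) (hα : Irrational α) (f : UnitAddCircle → ℝ)
    (hf : ZeroMeanBV f) : ∃ m : Measure UnitAddCircle, IsProbabilityMeasure m ∧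
      ∀ φ : UnitAddCircle → ℝ, Continuous φ →
        ∫ z, Real.exp (f z) * φ (z + (α : UnitAddCircle)) ∂m = ∫ z, φ z ∂m := by
  obtain ⟨C, hC⟩ := BS_DK α f hf
  have hc := hf.1
  set a : UnitAddCircle := (α : UnitAddCircle) with ha
  set w : ℕ → ℝ := fun j => Real.exp (BS f a j 0) with hw
  have hwpos : ∀ j, 0 < w j := fun j => Real.exp_pos _
  have hBS' : ∀ j, BS f a (j + 1) 0 = BS f a j 0 + f (j • a) := by
    intro j; unfold BS; rw [Finset.sum_range_succ]; simp
  have hwsucc : ∀ j, w (j + 1) = w j * Real.exp (f (j • a)) := by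
    intro j; simp only [hw, hBS', Real.exp_add]
  set Z : ℕ → ℝ := fun N => ∑ j ∈ Finset.range N, w j with hZ
  have hfreq : ∃ᶠ Q in atTop, ∃ P, QGood α Q P := by
    rw [Filter.frequently_atTop]
    intro N
    obtain ⟨Q, P, h1, h2⟩ := qp_good_frequently α hα N
    exact ⟨Q, h2, P, h1⟩
  have hZtop : Tendsto Z atTop atTop := by
    rw [hZ, ← not_summable_iff_tendsto_nat_atTop_of_nonneg (fun n => (hwpos n).le)]
    intro hs
    have h0 := hs.tendsto_atTop_zero
    have h1 := h0.eventually (gt_mem_nhds (Real.exp_pos (-C)))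
    obtain ⟨Q, ⟨P, hP⟩, hQ⟩ := (hfreq.and_eventually h1).exists
    have h2 := (abs_le.1 (hC Q P hP 0)).1
    have h3 : Real.exp (-C) ≤ w Q := Real.exp_le_exp.2 h2
    linarith
  set G : Filter ℕ := atTop ⊓ 𝓟 {Q | ∃ P, QGood α Q P} with hG
  have : G.NeBot := Filter.frequently_mem_iff_neBot.1 hfreq
  set U := Ultrafilter.of G
  have hUG : (U : Filter ℕ) ≤ G := Ultrafilter.of_le G
  have hUtop : (U : Filter ℕ) ≤ atTop := hUG.trans inf_le_left
  have hUgood : ∀ᶠ Q in (U : Filter ℕ), ∃ P, QGood α Q P :=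
    (hUG.trans inf_le_right) (mem_principal_self _)
  -- probability measures
  set M : ℕ → Measure UnitAddCircle := fun N =>
    ∑ j ∈ Finset.range (N + 1), ENNReal.ofReal (w j / Z (N + 1)) • Measure.dirac (j • a) with hM
  have hZpos : ∀ N, 0 < Z (N + 1) := fun N =>
    Finset.sum_pos (fun j _ => hwpos j) (by simp)
  have hMp : ∀ N, IsProbabilityMeasure (M N) := by
    intro N
    constructor
    simp only [hM, Measure.coe_finsetSum, Finset.sum_apply, Measure.smul_apply, measure_univ,
      smul_eq_mul, mul_one]
    rw [← ENNReal.ofReal_sum_of_nonneg (fun j _ => div_nonneg (hwpos j).le (hZpos N).le),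
      ← Finset.sum_div, div_self (hZpos N).ne', ENNReal.ofReal_one]
  have hMint : ∀ N (φ : UnitAddCircle → ℝ), Continuous φ →
      ∫ z, φ z ∂(M N) = (∑ j ∈ Finset.range (N + 1), w j * φ (j • a)) / Z (N + 1) := by
    intro N φ hφ
    simp only [hM]
    rw [integral_finsetSum_measure]
    · rw [Finset.sum_div]
      apply Finset.sum_congr rfl
      intro j _
      rw [integral_smul_measure, integral_dirac,
        ENNReal.toReal_ofReal (div_nonneg (hwpos j).le (hZpos N).le), smul_eq_mul]
      ring
    · intro j _
      exact (integ_cont _ φ hφ).smul_measure ENNReal.ofReal_ne_top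
  obtain ⟨m, hm, hlim⟩ := ultra_lim M hMp U
  refine ⟨m, hm, fun φ hφ => ?_⟩
  have hφ' : Continuous fun z => Real.exp (f z) * φ (z + a) := by fun_prop
  have l1 := hlim _ hφ'
  have l2 := hlim _ hφ
  obtain ⟨B, hB0, hB⟩ := cont_bdd φ hφ
  obtain ⟨Bf, hBf0, hBf⟩ := cont_bdd f hc
  have hdiff : ∀ N, ∫ z, Real.exp (f z) * φ (z + a) ∂(M N) - ∫ z, φ z ∂(M N) =
      (w (N + 1) * φ ((N + 1) • a) - w 0 * φ 0) / Z (N + 1) := by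
    intro N
    rw [hMint N _ hφ', hMint N _ hφ, ← sub_div, ← Finset.sum_sub_distrib]
    congr 1
    have := Finset.sum_range_sub (fun j => w j * φ (j • a)) (N + 1)
    simp only [zero_smul] at this
    rw [← this]
    apply Finset.sum_congr rfl
    intro j _
    rw [hwsucc, succ_nsmul]; ring
  have l3 : Tendsto (fun N => ∫ z, Real.exp (f z) * φ (z + a) ∂(M N) - ∫ z, φ z ∂(M N)) U
      (nhds 0) := by
    have hZ' : Tendsto (fun N => Z (N + 1)) U atTop :=
      (hZtop.comp (tendsto_add_atTop_nat 1)).mono_left hUtop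
    have hK : Tendsto (fun N => ((Real.exp C * Real.exp Bf + 1) * B) / Z (N + 1)) U (nhds 0) :=
      hZ'.const_div_atTop _
    apply squeeze_zero_norm' _ hK
    filter_upwards [hUgood] with N hN
    obtain ⟨P, hP⟩ := hN
    rw [hdiff, Real.norm_eq_abs, abs_div, abs_of_pos (hZpos N)]
    apply div_le_div_of_nonneg_right _ (hZpos N).le
    have b1 : w (N + 1) ≤ Real.exp C * Real.exp Bf := by
      rw [hwsucc]
      apply mul_le_mul
      · exact Real.exp_le_exp.2 (abs_le.1 (hC N P hP 0)).2
      · exact Real.exp_le_exp.2 (abs_le.1 (hBf _)).2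
      · positivity
      · positivity
    have b0 : w 0 = 1 := by simp [hw, BS]
    have b2 := hB ((N + 1) • a)
    have b3 := hB 0
    calc |w (N + 1) * φ ((N + 1) • a) - w 0 * φ 0|
        ≤ |w (N + 1) * φ ((N + 1) • a)| + |w 0 * φ 0| := abs_sub _ _
      _ = w (N + 1) * |φ ((N + 1) • a)| + |φ 0| := by
          rw [abs_mul, abs_of_pos (hwpos _), b0, one_mul]
      _ ≤ (Real.exp C * Real.exp Bf) * B + B := by
          gcongr
      _ = _ := by ring
  have := tendsto_nhds_unique (l1.sub l2) l3
  linarith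

theorem conf_map (f : UnitAddCircle → ℝ) (hf : Continuous f) (a : UnitAddCircle)
    (m : Measure UnitAddCircle) [IsProbabilityMeasure m]
    (hm : ∀ φ : UnitAddCircle → ℝ, Continuous φ →
        ∫ z, Real.exp (f z) * φ (z + a) ∂m = ∫ z, φ z ∂m) :
    (m.withDensity fun z => ENNReal.ofReal (Real.exp (f z))).map (fun z => z + a) = m := by
  have hmeas : Measurable fun z => ENNReal.ofReal (Real.exp (f z)) := by
    have := hf.measurable
    fun_prop
  have hT : Measurable fun z : UnitAddCircle => z + a := (continuous_add_const a).measurable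
  have : IsFiniteMeasure (m.withDensity fun z => ENNReal.ofReal (Real.exp (f z))) := by
    apply isFiniteMeasure_withDensity_ofReal
    exact (integ_cont m _ (Real.continuous_exp.comp hf)).2
  apply meas_ext
  intro φ hφ
  rw [integral_map hT.aemeasurable hφ.aestronglyMeasurable,
    integral_withDensity_eq_integral_toReal_smul hmeas (by simp), ← hm φ hφ]
  simp only [ENNReal.toReal_ofReal (Real.exp_pos _).le, smul_eq_mul]

theorem conf_int (f : UnitAddCircle → ℝ) (hf : Continuous f) (a : UnitAddCircle)
    (m : Measure UnitAddCircle)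
    (hm : (m.withDensity fun z => ENNReal.ofReal (Real.exp (f z))).map (fun z => z + a) = m)
    (ψ : UnitAddCircle → ℝ) (hψ : Measurable ψ) :
    ∫ z, Real.exp (f z) * ψ (z + a) ∂m = ∫ z, ψ z ∂m := by
  have hmeas : Measurable fun z => ENNReal.ofReal (Real.exp (f z)) := by
    have := hf.measurable
    fun_prop
  have hT : Measurable fun z : UnitAddCircle => z + a := (continuous_add_const a).measurable
  conv_rhs => rw [← hm]
  rw [integral_map hT.aemeasurable hψ.aestronglyMeasurable,
    integral_withDensity_eq_integral_toReal_smul hmeas (by simp)]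
  simp only [ENNReal.toReal_ofReal (Real.exp_pos _).le, smul_eq_mul]

theorem conf_iter (f : UnitAddCircle → ℝ) (hf : Continuous f) (a : UnitAddCircle)
    (m : Measure UnitAddCircle)
    (hm : (m.withDensity fun z => ENNReal.ofReal (Real.exp (f z))).map (fun z => z + a) = m)
    (n : ℕ) : ∀ (ψ : UnitAddCircle → ℝ), Measurable ψ →
    ∫ z, Real.exp (BS f a n z) * ψ (z + n • a) ∂m = ∫ z, ψ z ∂m := by
  induction n with
  | zero => intro ψ hψ; simp [BS]
  | succ n ih =>
    intro ψ hψ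
    rw [← ih ψ hψ]
    have h1 : Measurable fun z => Real.exp (BS f a n z) * ψ (z + n • a) :=
      (Real.continuous_exp.comp (BS_cont f hf a n)).measurable.mul
        (hψ.comp (continuous_add_const _).measurable)
    rw [← conf_int f hf a m hm _ h1]
    congr 1
    funext z
    rw [BS_succ, Real.exp_add, succ_nsmul]
    have : z + (n • a + a) = z + a + n • a := by abel
    rw [this]; ring

theorem conf_quasi (f : UnitAddCircle → ℝ) (hf : Continuous f) (a : UnitAddCircle)
    (m : Measure UnitAddCircle)
    (hm : (m.withDensity fun z => ENNReal.ofReal (Real.exp (f z))).map (fun z => z + a) = m) :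
    Measure.QuasiMeasurePreserving (fun z => z + a) m m := by
  have hmeas : Measurable fun z => ENNReal.ofReal (Real.exp (f z)) := by
    have := hf.measurable
    fun_prop
  have hT : Measurable fun z : UnitAddCircle => z + a := (continuous_add_const a).measurable
  refine ⟨hT, ?_⟩
  have h1 : m ≪ m.withDensity fun z => ENNReal.ofReal (Real.exp (f z)) :=
    withDensity_absolutelyContinuous' hmeas.aemeasurable
      (Filter.Eventually.of_forall fun z => by simp [Real.exp_pos])
  have := h1.map hT
  rwa [hm] at this

theorem qp_norm_nsmul_le (α : ℝ) (Q : ℕ) (P : ℤ) :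
    ‖Q • (α : UnitAddCircle)‖ ≤ |(Q : ℝ) * α - P| := by
  rw [← AddCircle.coe_nsmul, nsmul_eq_mul, UnitAddCircle.norm_eq]
  exact round_le _ _

theorem int_add3 (m : Measure UnitAddCircle) (u v w : UnitAddCircle → ℝ) (hu : Integrable u m)
    (hv : Integrable v m) (hw : Integrable w m) :
    ∫ z, (u z + v z + w z) ∂m = ∫ z, u z ∂m + ∫ z, v z ∂m + ∫ z, w z ∂m := by
  have h1 : Integrable (fun z => u z + v z) m := hu.add hv
  rw [integral_add h1 hw, integral_add hu hv]

theorem int_add4 (m : Measure UnitAddCircle) (u v w x : UnitAddCircle → ℝ) (hu : Integrable u m)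
    (hv : Integrable v m) (hw : Integrable w m) (hx : Integrable x m) :
    ∫ z, (u z + v z + w z + x z) ∂m =
      ∫ z, u z ∂m + ∫ z, v z ∂m + ∫ z, w z ∂m + ∫ z, x z ∂m := by
  have h1 : Integrable (fun z => u z + v z + w z) m := (hu.add hv).add hw
  rw [integral_add h1 hx, int_add3 m u v w hu hv hw]

/-- no eigenfunction for the eigenvalue -1 -/
theorem core_antiinv (α : ℝ) (hα : Irrational α) (f : UnitAddCircle → ℝ) (hf : ZeroMeanBV f)
    (m : Measure UnitAddCircle) [IsProbabilityMeasure m]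
    (hm : (m.withDensity fun z => ENNReal.ofReal (Real.exp (f z))).map
      (fun z => z + (α : UnitAddCircle)) = m)
    (h : UnitAddCircle → ℝ) (hmeas : Measurable h) (hb : ∀ z, |h z| ≤ 1)
    (hanti : ∀ᵐ z ∂m, h (z + (α : UnitAddCircle)) = - h z) : ∀ᵐ z ∂m, h z = 0 := by
  obtain ⟨C, hC⟩ := BS_DK α f hf
  have hc := hf.1
  set a : UnitAddCircle := (α : UnitAddCircle) with ha
  have hquasi := conf_quasi f hc a m hm
  have hiter : ∀ n : ℕ, ∀ᵐ z ∂m, h (z + n • a) = (-1) ^ n * h z := by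
    intro n
    induction n with
    | zero => simp
    | succ n ih =>
      have h1 := hquasi.ae ih
      filter_upwards [h1, hanti] with z h2 h3
      have : z + (n + 1) • a = z + a + n • a := by rw [succ_nsmul]; abel
      rw [this, h2, h3, pow_succ]; ring
  have hint : Integrable h m := integ_bdd m h hmeas 1 hb
  have habs : ∫ z, |h z| ∂m = 0 := by
    apply le_antisymm _ (integral_nonneg fun z => abs_nonneg _)
    apply le_of_forall_pos_le_add
    intro ε hε
    rw [zero_add]
    set K := Real.exp C + 2 with hK
    have hKpos : 0 < K := by positivity
    obtain ⟨φ, hφ, -⟩ := hint.exists_boundedContinuous_integral_sub_le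
      (show 0 < ε / K by positivity)
    have huc : UniformContinuous φ := CompactSpace.uniformContinuous_of_continuous φ.continuous
    rw [Metric.uniformContinuous_iff] at huc
    obtain ⟨δ, hδ, huc⟩ := huc (ε / K) (by positivity)
    obtain ⟨Q, P, hQ, hQδ⟩ := qp_good_exists α hα δ hδ
    have hCQ := hC Q P hQ
    set D : UnitAddCircle → ℝ := fun z => |h z - φ z| with hD
    have hDm : Measurable D := (hmeas.sub φ.continuous.measurable).abs
    have hDb : ∀ z, |D z| ≤ 1 + ‖φ‖ := by
      intro z
      simp only [hD, abs_abs]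
      have h1 := hb z
      have h2 := φ.norm_coe_le_norm z
      rw [Real.norm_eq_abs] at h2
      exact (abs_sub _ _).trans (by linarith)
    have hDint : Integrable D m := integ_bdd m D hDm _ hDb
    have hDQm : Measurable fun z => D (z + Q • a) := hDm.comp (continuous_add_const _).measurable
    have hDQint : Integrable (fun z => D (z + Q • a)) m := integ_bdd m _ hDQm _ fun z => hDb _
    have hDval : ∫ z, D z ∂m ≤ ε / K := by simpa [hD] using hφ
    have hDQ : ∫ z, D (z + Q • a) ∂m ≤ Real.exp C * (ε / K) := by
      have e := conf_iter f hc a m hm Q D hDm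
      have hle : ∫ z, D (z + Q • a) ∂m ≤
          ∫ z, Real.exp C * (Real.exp (BS f a Q z) * D (z + Q • a)) ∂m := by
        apply integral_mono hDQint
        · apply Integrable.const_mul
          refine integ_bdd m _ ((Real.continuous_exp.comp (BS_cont f hc a Q)).measurable.mul hDQm)
            (Real.exp C * (1 + ‖φ‖)) ?_
          intro z
          change |Real.exp (BS f a Q z) * D (z + Q • a)| ≤ _
          rw [abs_mul, abs_of_pos (Real.exp_pos _)]
          exact mul_le_mul (Real.exp_le_exp.2 (abs_le.1 (hCQ z)).2) (hDb _) (abs_nonneg _)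
            (Real.exp_pos _).le
        · intro z
          change D (z + Q • a) ≤ Real.exp C * (Real.exp (BS f a Q z) * D (z + Q • a))
          rw [← mul_assoc, ← Real.exp_add]
          have h1 : 1 ≤ Real.exp (C + BS f a Q z) :=
            Real.one_le_exp (by linarith [(abs_le.1 (hCQ z)).1])
          have h2 : 0 ≤ D (z + Q • a) := abs_nonneg _
          nlinarith
      rw [integral_const_mul, e] at hle
      exact hle.trans (mul_le_mul_of_nonneg_left hDval (Real.exp_pos _).le)
    have hpt : ∀ᵐ z ∂m, |h z| ≤ D (z + Q • a) + D z + ε / K := by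
      filter_upwards [hiter Q] with z hz
      rw [hQ.1.neg_one_pow] at hz
      have h1 : |φ (z + Q • a) - φ z| ≤ ε / K := by
        have := @huc (z + Q • a) z (by
          rw [dist_eq_norm, add_sub_cancel_left]
          exact (qp_norm_nsmul_le α Q P).trans_lt hQδ)
        rw [Real.dist_eq] at this
        exact this.le
      have h2 : 2 * h z = -((h (z + Q • a) - φ (z + Q • a)) + (φ (z + Q • a) - φ z)
          + -(h z - φ z)) := by rw [hz]; ring
      have h3 : 2 * |h z| ≤ D (z + Q • a) + ε / K + D z := by
        have : |2 * h z| = 2 * |h z| := by rw [abs_mul]; norm_num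
        rw [← this, h2, abs_neg]
        refine (abs_add_three _ _ _).trans ?_
        rw [abs_neg]
        simp only [hD]; linarith
      have := abs_nonneg (h z)
      linarith
    calc ∫ z, |h z| ∂m ≤ ∫ z, (D (z + Q • a) + D z + ε / K) ∂m := by
          apply integral_mono_ae hint.abs ((hDQint.add hDint).add (integrable_const _)) hpt
      _ = ∫ z, D (z + Q • a) ∂m + ∫ z, D z ∂m + ε / K := by
          rw [int_add3 m _ _ _ hDQint hDint (integrable_const _)]
          simp
      _ ≤ Real.exp C * (ε / K) + ε / K + ε / K := by linarith
      _ = K * (ε / K) := by rw [hK]; ring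
      _ = ε := by field_simp
  rw [integral_eq_zero_iff_of_nonneg (fun z => abs_nonneg _) hint.abs] at habs
  filter_upwards [habs] with z hz
  simpa using hz

theorem core_zero (α : ℝ) (hα : Irrational α) (f : UnitAddCircle → ℝ) (hf : ZeroMeanBV f)
    (m : Measure UnitAddCircle) [IsProbabilityMeasure m]
    (hm : (m.withDensity fun z => ENNReal.ofReal (Real.exp (f z))).map
      (fun z => z + (α : UnitAddCircle)) = m)
    (h : UnitAddCircle → ℝ) (hmeas : Measurable h) (hb : ∀ z, |h z| ≤ 1)
    (heq : ∀ φ : UnitAddCircle → ℝ, Continuous φ →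
      ∫ z, (Real.exp (f z) * φ (z + (α : UnitAddCircle)) + φ (z - (α : UnitAddCircle))) * h z ∂m =
        - ∫ z, (1 + Real.exp (f z)) * φ z * h z ∂m) : ∀ᵐ z ∂m, h z = 0 := by
  apply core_antiinv α hα f hf m hm h hmeas hb
  have hc := hf.1
  set a : UnitAddCircle := (α : UnitAddCircle) with ha
  obtain ⟨Bf, hBf0, hBf⟩ := cont_bdd f hc
  set E : UnitAddCircle → ℝ := fun z => Real.exp (f z) with hE
  have hEc : Continuous E := Real.continuous_exp.comp hc
  have hEm : Measurable E := hEc.measurable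
  have hE0 : ∀ z, 0 < E z := fun z => Real.exp_pos _
  have hEb : ∀ z, E z ≤ Real.exp Bf := fun z => Real.exp_le_exp.2 (abs_le.1 (hBf z)).2
  set L := Real.exp Bf
  have hL : 0 < L := Real.exp_pos _
  have hT : Measurable fun z : UnitAddCircle => z + a := (continuous_add_const a).measurable
  have hT' : Measurable fun z : UnitAddCircle => z - a := (continuous_sub_right a).measurable
  have hhT : Measurable fun z => h (z + a) := hmeas.comp hT
  have hhT' : Measurable fun z => h (z - a) := hmeas.comp hT'
  have cint : ∀ ψ : UnitAddCircle → ℝ, Measurable ψ →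
      ∫ z, E z * ψ (z + a) ∂m = ∫ z, ψ z ∂m := fun ψ hψ => conf_int f hc a m hm ψ hψ
  -- generic integrability of bounded products
  set r : UnitAddCircle → ℝ := fun z => h (z - a) + E z * h (z + a) + (1 + E z) * h z with hr
  have hrm : Measurable r := by
    simp only [hr]; fun_prop
  have hrb : ∀ z, |r z| ≤ 2 + 2 * L := by
    intro z
    have h1 := abs_le.1 (hb (z - a)); have h2 := abs_le.1 (hb (z + a)); have h3 := abs_le.1 (hb z)
    have h4 := hE0 z; have h5 := hEb z
    simp only [hr]
    rw [abs_le]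
    constructor <;> nlinarith
  have I : ∀ ψ : UnitAddCircle → ℝ, Measurable ψ → (∃ B, ∀ z, |ψ z| ≤ B) → Integrable ψ m :=
    fun ψ h1 ⟨B, hB⟩ => integ_bdd m ψ h1 B hB
  have bm : ∀ ψ χ : UnitAddCircle → ℝ, (∃ B, ∀ z, |ψ z| ≤ B) → (∃ B, ∀ z, |χ z| ≤ B) →
      ∃ B, ∀ z, |ψ z * χ z| ≤ B := by
    rintro ψ χ ⟨B, hB⟩ ⟨B', hB'⟩
    refine ⟨B * B', fun z => ?_⟩
    rw [abs_mul]
    exact mul_le_mul (hB z) (hB' z) (abs_nonneg _) ((abs_nonneg _).trans (hB z))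
  have bE : ∃ B, ∀ z, |E z| ≤ B := ⟨L, fun z => by rw [abs_of_pos (hE0 z)]; exact hEb z⟩
  have bE1 : ∃ B, ∀ z, |1 + E z| ≤ B := ⟨1 + L, fun z => by
    rw [abs_of_pos (by linarith [hE0 z])]; linarith [hEb z]⟩
  have bh : ∃ B, ∀ z, |h z| ≤ B := ⟨1, hb⟩
  have bhT : ∃ B, ∀ z, |h (z + a)| ≤ B := ⟨1, fun z => hb _⟩
  have bhT' : ∃ B, ∀ z, |h (z - a)| ≤ B := ⟨1, fun z => hb _⟩
  -- the weak equation
  have hweak : ∀ φ : UnitAddCircle → ℝ, Continuous φ → ∫ z, φ z * r z ∂m = 0 := by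
    intro φ hφ
    have hφm := hφ.measurable
    obtain ⟨B, hB0, hB⟩ := cont_bdd φ hφ
    have bφ : ∃ B, ∀ z, |φ z| ≤ B := ⟨B, hB⟩
    have bφT : ∃ B, ∀ z, |φ (z + a)| ≤ B := ⟨B, fun z => hB _⟩
    have bφT' : ∃ B, ∀ z, |φ (z - a)| ≤ B := ⟨B, fun z => hB _⟩
    have hφT : Measurable fun z => φ (z + a) := hφm.comp hT
    have hφT' : Measurable fun z => φ (z - a) := hφm.comp hT'
    have c1 := cint (fun z => φ z * h (z - a)) (by fun_prop)
    have c2 := cint (fun z => φ (z - a) * h z) (by fun_prop)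
    simp only [add_sub_cancel_right] at c1 c2
    have e := heq φ hφ
    have e1 : ∫ z, (E z * φ (z + a) + φ (z - a)) * h z ∂m =
        ∫ z, E z * (φ (z + a) * h z) ∂m + ∫ z, φ (z - a) * h z ∂m := by
      rw [← integral_add (I _ (by fun_prop) (bm _ _ bE (bm _ _ bφT bh)))
        (I _ (by fun_prop) (bm _ _ bφT' bh))]
      congr 1; funext z; ring
    change ∫ z, (E z * φ (z + a) + φ (z - a)) * h z ∂m = - ∫ z, (1 + E z) * φ z * h z ∂m at e
    rw [e1, c1, ← c2] at e
    have e2 : ∫ z, φ z * r z ∂m = ∫ z, φ z * h (z - a) ∂m + ∫ z, E z * (φ z * h (z + a)) ∂m +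
        ∫ z, (1 + E z) * φ z * h z ∂m := by
      rw [← integral_add (I _ (by fun_prop) (bm _ _ bφ bhT'))
        (I _ (by fun_prop) (bm _ _ bE (bm _ _ bφ bhT))), ← integral_add _ (I _ (by fun_prop)
        (bm _ _ (bm _ _ bE1 bφ) bh))]
      · congr 1; funext z; simp only [hr]; ring
      · exact (I _ (by fun_prop) (bm _ _ bφ bhT')).add
          (I _ (by fun_prop) (bm _ _ bE (bm _ _ bφ bhT)))
    rw [e2, e]; ring
  have br : ∃ B, ∀ z, |r z| ≤ B := ⟨_, hrb⟩
  have hhr : ∫ z, h z * r z ∂m = 0 := by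
    rw [← abs_eq_zero]
    apply le_antisymm _ (abs_nonneg _)
    apply le_of_forall_pos_le_add
    intro ε hε
    rw [zero_add]
    have hint : Integrable h m := I h hmeas bh
    set K := 2 + 2 * L
    have hK : 0 < K := by positivity
    obtain ⟨φ, hφ, -⟩ := hint.exists_boundedContinuous_integral_sub_le
      (show 0 < ε / K by positivity)
    have h1 := hweak φ φ.continuous
    have hφint : Integrable φ m := integ_cont m φ φ.continuous
    have hφm := φ.continuous.measurable
    have bφ : ∃ B, ∀ z, |φ z| ≤ B := ⟨‖φ‖, fun z => φ.norm_coe_le_norm z⟩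
    have h2 : ∫ z, h z * r z ∂m = ∫ z, (h z - φ z) * r z ∂m := by
      rw [← sub_zero (∫ z, h z * r z ∂m), ← h1, ← integral_sub (I _ (by fun_prop) (bm _ _ bh br))
        (I _ (by fun_prop) (bm _ _ bφ br))]
      congr 1; funext z; ring
    rw [h2]
    calc |∫ z, (h z - φ z) * r z ∂m| ≤ ∫ z, |(h z - φ z) * r z| ∂m := abs_integral_le_integral_abs
      _ ≤ ∫ z, ‖h z - φ z‖ * K ∂m := by
          apply integral_mono_of_nonneg (Filter.Eventually.of_forall fun z => abs_nonneg _)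
          · exact (hint.sub hφint).norm.mul_const K
          · refine Filter.Eventually.of_forall fun z => ?_
            simp only [abs_mul, Real.norm_eq_abs]
            exact mul_le_mul_of_nonneg_left (hrb z) (abs_nonneg _)
      _ = (∫ z, ‖h z - φ z‖ ∂m) * K := integral_mul_const _ _
      _ ≤ ε / K * K := by gcongr
      _ = ε := by field_simp
  have d1 := cint (fun z => h z * h (z - a)) (by fun_prop)
  have d2 := cint (fun z => h z * h z) (by fun_prop)
  simp only [add_sub_cancel_right] at d1
  have hsq : ∫ z, E z * ((h z + h (z + a)) * (h z + h (z + a))) ∂m = 0 := by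
    have i1 := I _ (by fun_prop) (bm _ _ bE (bm _ _ bhT bh))
    have i2 := I _ (by fun_prop) (bm _ _ bE (bm _ _ bhT bhT))
    have i3 := I _ (by fun_prop) (bm _ _ bE (bm _ _ bh bh))
    have i4 := I _ (by fun_prop) (bm _ _ bh bhT')
    have i5 := I _ (by fun_prop) (bm _ _ bh bh)
    have s1 : ∫ z, E z * ((h z + h (z + a)) * (h z + h (z + a))) ∂m =
        ∫ z, E z * (h (z + a) * h z) ∂m + ∫ z, E z * (h (z + a) * h z) ∂m +
        ∫ z, E z * (h (z + a) * h (z + a)) ∂m + ∫ z, E z * (h z * h z) ∂m := by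
      rw [← int_add4 m _ _ _ _ i1 i1 i2 i3]
      congr 1; funext z; ring
    have s2 : ∫ z, h z * r z ∂m =
        ∫ z, h z * h (z - a) ∂m + ∫ z, E z * (h (z + a) * h z) ∂m +
        ∫ z, h z * h z ∂m + ∫ z, E z * (h z * h z) ∂m := by
      rw [← int_add4 m _ _ _ _ i4 i1 i5 i3]
      congr 1; funext z; simp only [hr]; ring
    rw [s1, ← hhr, s2, ← d1, ← d2]
  have bs : ∃ B, ∀ z, |h z + h (z + a)| ≤ B := ⟨2, fun z => by
    refine (abs_add_le _ _).trans ?_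
    linarith [hb z, hb (z + a)]⟩
  have hsqI : Integrable (fun z => E z * ((h z + h (z + a)) * (h z + h (z + a)))) m :=
    I _ (hEm.mul ((hmeas.add hhT).mul (hmeas.add hhT))) (bm _ _ bE (bm _ _ bs bs))
  rw [integral_eq_zero_iff_of_nonneg
    (fun z => mul_nonneg (hE0 z).le (mul_self_nonneg _))
    hsqI] at hsq
  filter_upwards [hsq] with z hz
  simp only [Pi.zero_apply, mul_eq_zero, (hE0 z).ne', false_or, or_self] at hz
  linarith

theorem pOf_mul (f : UnitAddCircle → ℝ) (z) : (1 + Real.exp (f z)) * pOf f z = Real.exp (f z) := by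
  have := Real.exp_pos (f z)
  simp only [pOf]; field_simp

theorem pOf_cont (f : UnitAddCircle → ℝ) (hf : Continuous f) : Continuous (pOf f) := by
  have h1 : Continuous fun z => Real.exp (f z) := Real.continuous_exp.comp hf
  exact h1.div (continuous_const.add h1) fun z => by have := Real.exp_pos (f z); positivity

theorem pOf_ell (f : UnitAddCircle → ℝ) (hf : Continuous f) :
    ∃ d : ℝ, 0 < d ∧ ∀ z, d ≤ pOf f z ∧ pOf f z ≤ 1 - d := by
  obtain ⟨B, hB0, hB⟩ := cont_bdd f hf
  have hBp := Real.exp_pos B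
  refine ⟨1 / (1 + Real.exp B), by positivity, fun z => ?_⟩
  have h1 := Real.exp_pos (f z)
  have h2 : Real.exp (f z) ≤ Real.exp B := Real.exp_le_exp.2 (abs_le.1 (hB z)).2
  have h3 : Real.exp (-B) ≤ Real.exp (f z) := Real.exp_le_exp.2 (abs_le.1 (hB z)).1
  have h4 : Real.exp B * Real.exp (-B) = 1 := by rw [← Real.exp_add]; simp
  simp only [pOf]
  constructor
  · rw [div_le_div_iff₀ (by positivity) (by positivity)]
    nlinarith
  · rw [le_sub_iff_add_le, div_add_div _ _ (by positivity) (by positivity),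
      div_le_one (by positivity)]
    nlinarith

theorem Aop_cont (p : UnitAddCircle → ℝ) (hp : Continuous p) (α : ℝ) (φ : UnitAddCircle → ℝ)
    (hφ : Continuous φ) : Continuous (Aop p α φ) := by
  have h1 : Continuous fun z : UnitAddCircle => φ (z + (α : UnitAddCircle)) :=
    hφ.comp (continuous_add_const _)
  have h2 : Continuous fun z : UnitAddCircle => φ (z - (α : UnitAddCircle)) :=
    hφ.comp (continuous_sub_right _)
  exact (hp.mul h1).add ((continuous_const.sub hp).mul h2)

theorem Aop_iter_cont (p : UnitAddCircle → ℝ) (hp : Continuous p) (α : ℝ) (φ : UnitAddCircle → ℝ)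
    (hφ : Continuous φ) (n : ℕ) : Continuous ((Aop p α)^[n] φ) := by
  induction n with
  | zero => exact hφ
  | succ n ih => rw [Function.iterate_succ_apply']; exact Aop_cont p hp α _ ih

theorem Pop_fin (p : UnitAddCircle → ℝ) (hp : Continuous p) (α : ℝ) (ν : Measure UnitAddCircle)
    [IsFiniteMeasure ν] : IsFiniteMeasure (Pop p α ν) := by
  have h1 : IsFiniteMeasure (ν.withDensity fun z => ENNReal.ofReal (p z)) :=
    isFiniteMeasure_withDensity_ofReal (integ_cont ν _ hp).2
  have h2 : IsFiniteMeasure (ν.withDensity fun z => ENNReal.ofReal (1 - p z)) :=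
    isFiniteMeasure_withDensity_ofReal (integ_cont ν _ (continuous_const.sub hp)).2
  unfold Pop
  infer_instance

theorem Pop_int (p : UnitAddCircle → ℝ) (hp : Continuous p) (h01 : ∀ z, 0 ≤ p z ∧ p z ≤ 1)
    (α : ℝ) (ν : Measure UnitAddCircle)
    [IsFiniteMeasure ν] (φ : UnitAddCircle → ℝ) (hφ : Continuous φ) :
    ∫ z, φ z ∂(Pop p α ν) = ∫ z, Aop p α φ z ∂ν := by
  have h1 : IsFiniteMeasure (ν.withDensity fun z => ENNReal.ofReal (p z)) :=
    isFiniteMeasure_withDensity_ofReal (integ_cont ν _ hp).2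
  have h2 : IsFiniteMeasure (ν.withDensity fun z => ENNReal.ofReal (1 - p z)) :=
    isFiniteMeasure_withDensity_ofReal (integ_cont ν _ (continuous_const.sub hp)).2
  have hpm := hp.measurable
  have hm1 : Measurable fun z => ENNReal.ofReal (p z) := by fun_prop
  have hm2 : Measurable fun z => ENNReal.ofReal (1 - p z) := by fun_prop
  have hT : Continuous fun z : UnitAddCircle => z + (α : UnitAddCircle) := continuous_add_const _
  have hT' : Continuous fun z : UnitAddCircle => z - (α : UnitAddCircle) := continuous_sub_right _
  unfold Pop
  rw [integral_add_measure (integ_cont _ _ hφ) (integ_cont _ _ hφ),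
    integral_map hT.measurable.aemeasurable hφ.aestronglyMeasurable,
    integral_map hT'.measurable.aemeasurable hφ.aestronglyMeasurable,
    integral_withDensity_eq_integral_toReal_smul hm1 (by simp),
    integral_withDensity_eq_integral_toReal_smul hm2 (by simp)]
  simp only [ENNReal.toReal_ofReal (h01 _).1, ENNReal.toReal_ofReal (sub_nonneg.2 (h01 _).2),
    smul_eq_mul]
  have i1 : Integrable (fun z => p z * φ (z + (α : UnitAddCircle))) ν :=
    integ_cont _ _ (hp.mul (hφ.comp hT))
  have i2 : Integrable (fun z => (1 - p z) * φ (z - (α : UnitAddCircle))) ν :=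
    integ_cont _ _ ((continuous_const.sub hp).mul (hφ.comp hT'))
  rw [← integral_add i1 i2]
  rfl

theorem Pop_prob (p : UnitAddCircle → ℝ) (hp : Continuous p) (h01 : ∀ z, 0 ≤ p z ∧ p z ≤ 1)
    (α : ℝ) (ν : Measure UnitAddCircle)
    [IsProbabilityMeasure ν] : IsProbabilityMeasure (Pop p α ν) := by
  have := Pop_fin p hp α ν
  have h := Pop_int p hp h01 α ν (fun _ => 1) continuous_const
  have e : Aop p α (fun _ => 1) = fun _ => 1 := by funext z; simp [Aop]
  rw [e] at h
  simp only [integral_const, smul_eq_mul, mul_one, probReal_univ] at h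
  constructor
  rw [Measure.real, ENNReal.toReal_eq_one_iff] at h
  exact h

theorem prob_of_int (μ : Measure UnitAddCircle) (h : ∫ _z, (1 : ℝ) ∂μ = 1) :
    IsProbabilityMeasure μ := by
  simp only [integral_const, smul_eq_mul, mul_one] at h
  constructor
  rwa [Measure.real, ENNReal.toReal_eq_one_iff] at h

theorem conf_sum (f : UnitAddCircle → ℝ) (hf : Continuous f) (a : UnitAddCircle)
    (m : Measure UnitAddCircle) [IsProbabilityMeasure m]
    (hm : (m.withDensity fun z => ENNReal.ofReal (Real.exp (f z))).map (fun z => z + a) = m)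
    (φ : UnitAddCircle → ℝ) (hφ : Continuous φ) :
    ∫ z, (Real.exp (f z) * φ (z + a) + φ (z - a)) ∂m = ∫ z, (1 + Real.exp (f z)) * φ z ∂m := by
  have hT : Continuous fun z : UnitAddCircle => z + a := continuous_add_const _
  have hT' : Continuous fun z : UnitAddCircle => z - a := continuous_sub_right _
  have hE : Continuous fun z => Real.exp (f z) := Real.continuous_exp.comp hf
  have c1 := conf_int f hf a m hm φ hφ.measurable
  have c2 := conf_int f hf a m hm (fun z => φ (z - a)) (hφ.comp hT').measurable
  simp only [add_sub_cancel_right] at c2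
  have i1 : Integrable (fun z => Real.exp (f z) * φ (z + a)) m :=
    integ_cont m _ (hE.mul (hφ.comp hT))
  have i2 : Integrable (fun z => φ (z - a)) m := integ_cont m _ (hφ.comp hT')
  have i3 : Integrable (fun z => Real.exp (f z) * φ z) m := integ_cont m _ (hE.mul hφ)
  rw [integral_add i1 i2, c1, ← c2, ← integral_add (integ_cont m _ hφ) i3]
  congr 1; funext z; ring

theorem Aop_pOf (f : UnitAddCircle → ℝ) (α : ℝ) (φ : UnitAddCircle → ℝ) (z) :
    (1 + Real.exp (f z)) * Aop (pOf f) α φ z =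
      Real.exp (f z) * φ (z + (α : UnitAddCircle)) + φ (z - (α : UnitAddCircle)) := by
  have h := pOf_mul f z
  simp only [Aop]
  linear_combination (φ (z + (α : UnitAddCircle)) - φ (z - (α : UnitAddCircle))) * h

theorem lim_unique (α : ℝ) (hα : Irrational α) (f : UnitAddCircle → ℝ) (hf : ZeroMeanBV f)
    (μs : Measure UnitAddCircle) (hμ : IsUniqueStationary (pOf f) α μs)
    (ν : Measure UnitAddCircle) [IsProbabilityMeasure ν]
    (hν : ∀ φ : UnitAddCircle → ℝ, Continuous φ →
      ∫ z, Aop (pOf f) α (Aop (pOf f) α φ) z ∂ν = ∫ z, φ z ∂ν)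
    (φ : UnitAddCircle → ℝ) (hφ : Continuous φ) : ∫ z, φ z ∂ν = ∫ z, φ z ∂μs := by
  obtain ⟨hμp, hμs, hμu⟩ := hμ
  have hc := hf.1
  set p := pOf f with hp
  have hpc : Continuous p := pOf_cont f hc
  obtain ⟨d, hd, hdp⟩ := pOf_ell f hc
  have h01 : ∀ z, 0 ≤ p z ∧ p z ≤ 1 := fun z => ⟨by linarith [(hdp z).1], by linarith [(hdp z).2]⟩
  obtain ⟨m, hmp, hm⟩ := conformal_exists α hα f hf
  have hmap := conf_map f hc (α : UnitAddCircle) m hm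
  have hE : Continuous fun z => Real.exp (f z) := Real.continuous_exp.comp hc
  have hE1 : Continuous fun z => 1 + Real.exp (f z) := continuous_const.add hE
  have hEpos : ∀ z, 0 < 1 + Real.exp (f z) := fun z => by have := Real.exp_pos (f z); positivity
  -- W = 2 μs
  set W : Measure UnitAddCircle := m.withDensity fun z => ENNReal.ofReal (1 + Real.exp (f z)) with hR
  have hRmeas : Measurable fun z => ENNReal.ofReal (1 + Real.exp (f z)) := by
    have := hE1.measurable
    fun_prop
  have hRfin : IsFiniteMeasure W := isFiniteMeasure_withDensity_ofReal (integ_cont m _ hE1).2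
  have hWint : ∀ ψ : UnitAddCircle → ℝ, ∫ z, ψ z ∂W = ∫ z, (1 + Real.exp (f z)) * ψ z ∂m := by
    intro ψ
    rw [hR, integral_withDensity_eq_integral_toReal_smul hRmeas (by simp)]
    simp only [ENNReal.toReal_ofReal (hEpos _).le, smul_eq_mul]
  have hhalf : ((1 / 2 : NNReal) : ℝ) = 1 / 2 := by norm_num
  have hμR : ∀ ψ : UnitAddCircle → ℝ, Continuous ψ → ∫ z, ψ z ∂μs = 1 / 2 * ∫ z, ψ z ∂W := by
    have hfin : IsFiniteMeasure ((1 / 2 : NNReal) • W) := inferInstance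
    have hint : ∀ ψ : UnitAddCircle → ℝ, ∫ z, ψ z ∂((1 / 2 : NNReal) • W) = 1 / 2 * ∫ z, ψ z ∂W := by
      intro ψ
      rw [integral_smul_nnreal_measure, NNReal.smul_def, hhalf, smul_eq_mul]
    have hprob : IsProbabilityMeasure ((1 / 2 : NNReal) • W) := by
      have h1 := hint fun _ => 1
      have h2 := hm (fun _ => 1) continuous_const
      have i1 : Integrable (fun z => Real.exp (f z) * 1) m :=
        integ_cont m _ (hE.mul continuous_const)
      have i2 : ∫ z, (1 + Real.exp (f z)) * 1 ∂m = ∫ z, (1 + Real.exp (f z) * 1) ∂m := by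
        congr 1; funext z; ring
      rw [hWint, i2, integral_add (integrable_const _) i1, h2] at h1
      apply prob_of_int
      rw [h1]
      simp only [integral_const, smul_eq_mul, mul_one, probReal_univ]
      norm_num
    have hstat : Pop p α ((1 / 2 : NNReal) • W) = (1 / 2 : NNReal) • W := by
      have := Pop_fin p hpc α ((1 / 2 : NNReal) • W)
      apply meas_ext
      intro ψ hψ
      rw [Pop_int p hpc h01 α _ ψ hψ, hint, hint, hWint, hWint,
        ← conf_sum f hc (α : UnitAddCircle) m hmap ψ hψ]
      simp only [hp, Aop_pOf]
    intro ψ hψ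
    rw [← hμu _ hprob hstat, hint]
  -- ν + ν' = W
  set ν' := Pop p α ν with hν'
  have hν'p : IsProbabilityMeasure ν' := Pop_prob p hpc h01 α ν
  have hν'int : ∀ ψ : UnitAddCircle → ℝ, Continuous ψ → ∫ z, ψ z ∂ν' = ∫ z, Aop p α ψ z ∂ν :=
    fun ψ hψ => Pop_int p hpc h01 α ν ψ hψ
  have hsum : ν + ν' = W := by
    have hint : ∀ ψ : UnitAddCircle → ℝ, Continuous ψ → ∫ z, ψ z ∂((1 / 2 : NNReal) • (ν + ν')) =
        1 / 2 * (∫ z, ψ z ∂ν + ∫ z, ψ z ∂ν') := by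
      intro ψ hψ
      rw [integral_smul_nnreal_measure, NNReal.smul_def, hhalf, smul_eq_mul,
        integral_add_measure (integ_cont _ _ hψ) (integ_cont _ _ hψ)]
    have hprob : IsProbabilityMeasure ((1 / 2 : NNReal) • (ν + ν')) := by
      have h1 := hint (fun _ => 1) continuous_const
      apply prob_of_int
      rw [h1]
      simp only [integral_const, smul_eq_mul, mul_one, probReal_univ]
      norm_num
    have hstat : Pop p α ((1 / 2 : NNReal) • (ν + ν')) = (1 / 2 : NNReal) • (ν + ν') := by
      have := Pop_fin p hpc α ((1 / 2 : NNReal) • (ν + ν'))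
      apply meas_ext
      intro ψ hψ
      rw [Pop_int p hpc h01 α _ ψ hψ, hint _ (Aop_cont p hpc α ψ hψ), hint ψ hψ,
        hν'int _ (Aop_cont p hpc α ψ hψ), hν ψ hψ, hν'int ψ hψ, add_comm]
    have h2 := hμu _ hprob hstat
    apply meas_ext
    intro ψ hψ
    have h3 := hint ψ hψ
    rw [h2, hμR ψ hψ] at h3
    rw [integral_add_measure (integ_cont _ _ hψ) (integ_cont _ _ hψ)]
    linarith
  have hle : ν ≤ W := by rw [← hsum]; exact Measure.le_add_right le_rfl
  have hLD : ν.HaveLebesgueDecomposition W :=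
    Measure.haveLebesgueDecomposition_of_sigmaFinite ν W
  have hac : ν ≪ W := Measure.absolutelyContinuous_of_le hle
  set κ : UnitAddCircle → ℝ := fun z => (min (ν.rnDeriv W z) 1).toReal with hκ
  have hκm : Measurable κ := by
    have := Measure.measurable_rnDeriv ν W
    simp only [hκ]; fun_prop
  have hκ0 : ∀ z, 0 ≤ κ z := fun z => ENNReal.toReal_nonneg
  have hκ1 : ∀ z, κ z ≤ 1 := fun z =>
    ENNReal.toReal_mono (b := 1) ENNReal.one_ne_top (min_le_right _ _)
  have hκint : ∀ ψ : UnitAddCircle → ℝ, ∫ z, ψ z ∂ν = ∫ z, (1 + Real.exp (f z)) * (κ z * ψ z) ∂m := by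
    intro ψ
    rw [← hWint fun z => κ z * ψ z]
    conv_lhs => rw [← Measure.withDensity_rnDeriv_eq ν W hac]
    rw [integral_withDensity_eq_integral_toReal_smul (Measure.measurable_rnDeriv ν W)
      (Measure.rnDeriv_lt_top ν W)]
    apply integral_congr_ae
    filter_upwards [Measure.rnDeriv_le_one_of_le hle] with z hz
    have hz' : ν.rnDeriv W z ≤ 1 := hz
    simp only [hκ, smul_eq_mul, min_eq_left hz']
  set h : UnitAddCircle → ℝ := fun z => 2 * κ z - 1 with hh
  have hhm : Measurable h := (hκm.const_mul 2).sub_const 1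
  have hhb : ∀ z, |h z| ≤ 1 := fun z => by
    rw [abs_le]; simp only [hh]; constructor <;> linarith [hκ0 z, hκ1 z]
  have hI : ∀ ψ : UnitAddCircle → ℝ, Continuous ψ → Integrable (fun z => ψ z * κ z) m := by
    intro ψ hψ
    obtain ⟨B, hB0, hB⟩ := cont_bdd ψ hψ
    refine integ_bdd m _ (hψ.measurable.mul hκm) B fun z => ?_
    rw [abs_mul, abs_of_nonneg (hκ0 z)]
    have := hB z
    nlinarith [hκ1 z, hκ0 z, abs_nonneg (ψ z)]
  have hI2 : ∀ ψ : UnitAddCircle → ℝ, Continuous ψ →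
      ∫ z, ψ z * h z ∂m = 2 * ∫ z, ψ z * κ z ∂m - ∫ z, ψ z ∂m := by
    intro ψ hψ
    rw [← integral_const_mul, ← integral_sub ((hI ψ hψ).const_mul 2) (integ_cont m _ hψ)]
    congr 1; funext z; simp only [hh]; ring
  have hzero : ∀ᵐ z ∂m, h z = 0 := by
    apply core_zero α hα f hf m hmap h hhm hhb
    intro ψ hψ
    have hT : Continuous fun z : UnitAddCircle => z + (α : UnitAddCircle) := continuous_add_const _
    have hT' : Continuous fun z : UnitAddCircle => z - (α : UnitAddCircle) := continuous_sub_right _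
    have c1 : Continuous fun z => Real.exp (f z) * ψ (z + (α : UnitAddCircle)) +
        ψ (z - (α : UnitAddCircle)) := (hE.mul (hψ.comp hT)).add (hψ.comp hT')
    have c2 : Continuous fun z => (1 + Real.exp (f z)) * ψ z := hE1.mul hψ
    rw [hI2 _ c1, hI2 _ c2,
      conf_sum f hc _ m hmap ψ hψ]
    have e1 : ∫ z, (Real.exp (f z) * ψ (z + (α : UnitAddCircle)) + ψ (z - (α : UnitAddCircle)))
        * κ z ∂m = ∫ z, ψ z ∂ν' := by
      rw [hν'int ψ hψ, hκint]
      congr 1; funext z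
      rw [← Aop_pOf f α ψ z]; ring
    have e2 : ∫ z, (1 + Real.exp (f z)) * ψ z * κ z ∂m = ∫ z, ψ z ∂ν := by
      rw [hκint]; congr 1; funext z; ring
    have e3 : ∫ z, ψ z ∂ν + ∫ z, ψ z ∂ν' = ∫ z, (1 + Real.exp (f z)) * ψ z ∂m := by
      rw [← hWint, ← hsum, integral_add_measure (integ_cont _ _ hψ) (integ_cont _ _ hψ)]
    rw [e1, e2, ← e3]; ring
  rw [hκint, hμR φ hφ, hWint, ← integral_const_mul]
  apply integral_congr_ae
  filter_upwards [hzero] with z hz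
  have : κ z = 1 / 2 := by simp only [hh] at hz; linarith
  simp only [this]; ring

theorem qp_main (α : ℝ) (hα : Irrational α) (f : UnitAddCircle → ℝ) (hf : ZeroMeanBV f)
    (μs : Measure UnitAddCircle) (hμ : IsUniqueStationary (pOf f) α μs) (x : UnitAddCircle)
    (M : ℕ → Measure UnitAddCircle) (hMp : ∀ n, IsProbabilityMeasure (M n))
    (hM : ∀ n, ∀ φ : UnitAddCircle → ℝ, Continuous φ →
      ∫ z, φ z ∂(M n) = ((Aop (pOf f) α)^[n] φ) x)
    (φ : UnitAddCircle → ℝ) (hφ : Continuous φ) :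
    Tendsto (fun n => ∫ z, φ z ∂(M n)) atTop (nhds (∫ z, φ z ∂μs)) := by
  have hc := hf.1
  have hpc : Continuous (pOf f) := pOf_cont f hc
  obtain ⟨d, hd, hdp⟩ := pOf_ell f hc
  rw [tendsto_iff_ultrafilter]
  intro U hU
  obtain ⟨ν, hνp, hν⟩ := ultra_lim M hMp U
  have h2 : ∀ ψ : UnitAddCircle → ℝ, Continuous ψ →
      ∫ z, Aop (pOf f) α (Aop (pOf f) α ψ) z ∂ν = ∫ z, ψ z ∂ν := by
    intro ψ hψ
    obtain ⟨B, hB0, hB⟩ := cont_bdd ψ hψ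
    have h3 := (Aop_asymp (pOf f) α d hd hdp ψ B hB x).mono_left hU
    have h4 := (hν ψ hψ).sub (hν _ (Aop_cont _ hpc α _ (Aop_cont _ hpc α ψ hψ)))
    have h5 : (fun n => ∫ z, ψ z ∂(M n) - ∫ z, Aop (pOf f) α (Aop (pOf f) α ψ) z ∂(M n)) =
        fun n => ((Aop (pOf f) α)^[n] ψ) x - ((Aop (pOf f) α)^[n + 2] ψ) x := by
      funext n
      rw [hM n ψ hψ, hM n _ (Aop_cont _ hpc α _ (Aop_cont _ hpc α ψ hψ))]
      rfl
    rw [h5] at h4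
    have := tendsto_nhds_unique h3 h4
    linarith
  rw [← lim_unique α hα f hf μs hμ ν h2 φ hφ]
  exact hν φ hφ

theorem stepProb_nonneg (p : UnitAddCircle → ℝ) (h01 : ∀ z, 0 ≤ p z ∧ p z ≤ 1) (α : ℝ)
    (x : UnitAddCircle) (j k : ℤ) : 0 ≤ stepProb p α x j k := by
  unfold stepProb
  split_ifs
  · exact (h01 _).1
  · linarith [(h01 (pt α x j)).2]
  · exact le_rfl

theorem walk_step (p : UnitAddCircle → ℝ) (h01 : ∀ z, 0 ≤ p z ∧ p z ≤ 1) (α : ℝ)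
    (x : UnitAddCircle) {Ω : Type} [MeasurableSpace Ω] (ℙ : Measure Ω) (ξ : ℕ → Ω → ℤ)
    (hw : IsQPWalk p α x 0 ℙ ξ) (n : ℕ) (b : ℤ) :
    ℙ {ω | ξ (n + 1) ω = b} = ∫⁻ ω, ENNReal.ofReal (stepProb p α x (ξ n ω) b) ∂ℙ := by
  obtain ⟨hP, hmeas, hfdd⟩ := hw
  set path : Ω → (Fin (n + 1) → ℤ) := fun ω i => ξ i ω with hpath
  have hpm : Measurable path := measurable_pi_lambda _ fun i => hmeas i
  have hSm : MeasurableSet {ω | ξ (n + 1) ω = b} := hmeas (n + 1) (measurableSet_singleton b)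
  have h1 : ℙ {ω | ξ (n + 1) ω = b} =
      ∑' k : Fin (n + 1) → ℤ, ℙ (path ⁻¹' {k} ∩ {ω | ξ (n + 1) ω = b}) := by
    have e : ∫⁻ _k, 1 ∂((ℙ.restrict {ω | ξ (n + 1) ω = b}).map path) =
        ℙ {ω | ξ (n + 1) ω = b} := by
      rw [lintegral_one, Measure.map_apply hpm MeasurableSet.univ]
      simp
    rw [← e, lintegral_countable']
    congr 1; funext k
    rw [one_mul, Measure.map_apply hpm (measurableSet_singleton k),
      Measure.restrict_apply (hpm (measurableSet_singleton k))]
  have h2 : ∫⁻ ω, ENNReal.ofReal (stepProb p α x (ξ n ω) b) ∂ℙ =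
      ∑' k : Fin (n + 1) → ℤ, ENNReal.ofReal (stepProb p α x (k (Fin.last n)) b) *
        ℙ (path ⁻¹' {k}) := by
    have e : ∫⁻ ω, ENNReal.ofReal (stepProb p α x (ξ n ω) b) ∂ℙ =
        ∫⁻ k, ENNReal.ofReal (stepProb p α x (k (Fin.last n)) b) ∂(ℙ.map path) := by
      rw [lintegral_map Measurable.of_discrete hpm]
      simp [hpath]
    rw [e, lintegral_countable']
    congr 1; funext k
    rw [Measure.map_apply hpm (measurableSet_singleton k)]
  rw [h1, h2]
  congr 1; funext k
  set kk : ℕ → ℤ := fun i => if h : i < n + 1 then k ⟨i, h⟩ else b with hkk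
  have hk1 : path ⁻¹' {k} = {ω | ∀ i ≤ n, ξ i ω = kk i} := by
    ext ω
    simp only [Set.mem_preimage, Set.mem_singleton_iff, Set.mem_setOf_eq, hpath, hkk, funext_iff]
    constructor
    · intro h i hi
      rw [dif_pos (Nat.lt_succ_of_le hi)]
      exact h ⟨i, Nat.lt_succ_of_le hi⟩
    · intro h i
      have := h i (Nat.le_of_lt_succ i.2)
      rw [dif_pos i.2] at this
      exact this
  have hkb : kk (n + 1) = b := by simp [hkk]
  have hkn : kk n = k (Fin.last n) := by simp [hkk, Fin.last]
  have hk2 : path ⁻¹' {k} ∩ {ω | ξ (n + 1) ω = b} = {ω | ∀ i ≤ n + 1, ξ i ω = kk i} := by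
    rw [hk1]
    ext ω
    simp only [Set.mem_inter_iff, Set.mem_setOf_eq]
    constructor
    · rintro ⟨h, h'⟩ i hi
      rcases Nat.lt_or_ge n i with hlt | hge
      · have : i = n + 1 := by omega
        rw [this, hkb, h']
      · exact h i hge
    · intro h
      exact ⟨fun i hi => h i (by omega), by rw [h (n + 1) le_rfl, hkb]⟩
  rw [hk2, hk1, hfdd, hfdd, Finset.prod_range_succ, hkb, hkn,
    ← ENNReal.ofReal_mul (stepProb_nonneg p h01 α x _ _)]
  congr 1; ring

theorem pt_succ (α : ℝ) (x : UnitAddCircle) (j : ℤ) : pt α x (j + 1) = pt α x j + (α : UnitAddCircle) := by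
  unfold pt
  push_cast
  rw [add_mul, one_mul, AddCircle.coe_add, add_assoc]

theorem pt_pred (α : ℝ) (x : UnitAddCircle) (j : ℤ) : pt α x (j - 1) = pt α x j - (α : UnitAddCircle) := by
  unfold pt
  push_cast
  rw [sub_mul, one_mul, AddCircle.coe_sub, add_sub_assoc]

theorem walk_lint (p : UnitAddCircle → ℝ) (h01 : ∀ z, 0 ≤ p z ∧ p z ≤ 1) (α : ℝ)
    (x : UnitAddCircle) {Ω : Type} [MeasurableSpace Ω] (ℙ : Measure Ω) (ξ : ℕ → Ω → ℤ)
    (hw : IsQPWalk p α x 0 ℙ ξ) (n : ℕ) (φ : UnitAddCircle → ℝ) (h0 : ∀ z, 0 ≤ φ z) :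
    ∫⁻ ω, ENNReal.ofReal (φ (pt α x (ξ (n + 1) ω))) ∂ℙ =
      ∫⁻ ω, ENNReal.ofReal (Aop p α φ (pt α x (ξ n ω))) ∂ℙ := by
  have hmeas := hw.2.1
  have e : ∫⁻ ω, ENNReal.ofReal (φ (pt α x (ξ (n + 1) ω))) ∂ℙ =
      ∫⁻ j, ENNReal.ofReal (φ (pt α x j)) ∂(ℙ.map (ξ (n + 1))) := by
    rw [lintegral_map Measurable.of_discrete (hmeas _)]
  rw [e, lintegral_countable']
  have e2 : ∀ b : ℤ, ENNReal.ofReal (φ (pt α x b)) * (ℙ.map (ξ (n + 1))) {b} =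
      ∫⁻ ω, ENNReal.ofReal (φ (pt α x b)) * ENNReal.ofReal (stepProb p α x (ξ n ω) b) ∂ℙ := by
    intro b
    have hm : Measurable fun ω => ENNReal.ofReal (stepProb p α x (ξ n ω) b) :=
      (Measurable.of_discrete (f := fun j : ℤ => ENNReal.ofReal (stepProb p α x j b))).comp (hmeas n)
    rw [lintegral_const_mul _ hm, ← walk_step p h01 α x ℙ ξ hw n b,
      Measure.map_apply (hmeas _) (measurableSet_singleton b)]
    rfl
  simp only [e2]
  rw [← lintegral_tsum]
  · congr 1; funext ω
    set j := ξ n ω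
    rw [tsum_eq_sum (s := {j + 1, j - 1})]
    · rw [Finset.sum_pair (by omega)]
      have n1 : ¬ (j - 1 = j + 1) := by omega
      simp only [stepProb, n1, if_true, if_false, pt_succ, pt_pred]
      have hp := h01 (pt α x j)
      rw [← ENNReal.ofReal_mul (h0 _), ← ENNReal.ofReal_mul (h0 _),
        ← ENNReal.ofReal_add (mul_nonneg (h0 _) hp.1) (mul_nonneg (h0 _) (by linarith))]
      congr 1; simp only [Aop]; ring
    · intro b hb
      simp only [Finset.mem_insert, Finset.mem_singleton, not_or] at hb
      simp [stepProb, hb.1, hb.2]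
  · intro b
    have hm : Measurable fun ω => ENNReal.ofReal (φ (pt α x b)) * ENNReal.ofReal (stepProb p α x (ξ n ω) b) :=
      (Measurable.of_discrete (f := fun j : ℤ => ENNReal.ofReal (φ (pt α x b)) *
        ENNReal.ofReal (stepProb p α x j b))).comp (hmeas n)
    exact hm.aemeasurable

theorem pt_meas (α : ℝ) (x : UnitAddCircle) {Ω : Type} [MeasurableSpace Ω] (g : Ω → ℤ)
    (hg : Measurable g) : Measurable fun ω => pt α x (g ω) :=
  (Measurable.of_discrete (f := fun j : ℤ => pt α x j)).comp hg

theorem walk_int (p : UnitAddCircle → ℝ) (hp : Continuous p) (h01 : ∀ z, 0 ≤ p z ∧ p z ≤ 1) (α : ℝ)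
    (x : UnitAddCircle) {Ω : Type} [MeasurableSpace Ω] (ℙ : Measure Ω) (ξ : ℕ → Ω → ℤ)
    (hw : IsQPWalk p α x 0 ℙ ξ) (n : ℕ) (φ : UnitAddCircle → ℝ) (hφ : Continuous φ) :
    ∫ ω, φ (pt α x (ξ (n + 1) ω)) ∂ℙ = ∫ ω, Aop p α φ (pt α x (ξ n ω)) ∂ℙ := by
  have hP := hw.1
  have hmeas := hw.2.1
  obtain ⟨B, hB0, hB⟩ := cont_bdd φ hφ
  have I : ∀ (ψ : UnitAddCircle → ℝ), Continuous ψ → ∀ k,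
      Integrable (fun ω => ψ (pt α x (ξ k ω))) ℙ := by
    intro ψ hψ k
    obtain ⟨B, hB0, hB⟩ := cont_bdd ψ hψ
    exact integ_bdd ℙ _ (hψ.measurable.comp (pt_meas α x _ (hmeas k))) B fun _ => hB _
  have h0 : ∀ z, 0 ≤ φ z + B := fun z => by linarith [(abs_le.1 (hB z)).1]
  have hA : ∀ z, Aop p α (fun z => φ z + B) z = Aop p α φ z + B := by
    intro z; simp only [Aop]; ring
  have hA0 : ∀ z, 0 ≤ Aop p α φ z + B := by
    intro z
    have := abs_le.1 (Aop_bound p α h01 φ B hB z)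
    linarith [this.1]
  have hL := walk_lint p h01 α x ℙ ξ hw n (fun z => φ z + B) h0
  simp only [hA] at hL
  have i1 := I φ hφ (n + 1)
  have i2 := I _ (Aop_cont p hp α φ hφ) n
  have key : ∫ ω, (φ (pt α x (ξ (n + 1) ω)) + B) ∂ℙ = ∫ ω, (Aop p α φ (pt α x (ξ n ω)) + B) ∂ℙ := by
    rw [integral_eq_lintegral_of_nonneg_ae (Eventually.of_forall fun ω => h0 _)
        (i1.add (integrable_const B)).1,
      integral_eq_lintegral_of_nonneg_ae (Eventually.of_forall fun ω => hA0 _)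
        (i2.add (integrable_const B)).1, hL]
  rw [integral_add i1 (integrable_const B), integral_add i2 (integrable_const B)] at key
  linarith

theorem walk_iter (p : UnitAddCircle → ℝ) (hp : Continuous p) (h01 : ∀ z, 0 ≤ p z ∧ p z ≤ 1) (α : ℝ)
    (x : UnitAddCircle) {Ω : Type} [MeasurableSpace Ω] (ℙ : Measure Ω) (ξ : ℕ → Ω → ℤ)
    (hw : IsQPWalk p α x 0 ℙ ξ) (n : ℕ) : ∀ (φ : UnitAddCircle → ℝ), Continuous φ →
    ∫ ω, φ (pt α x (ξ n ω)) ∂ℙ = ((Aop p α)^[n] φ) x := by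
  have hP := hw.1
  induction n with
  | zero =>
    intro φ hφ
    have h1 := hw.2.2 0 fun _ => 0
    simp only [if_true, Finset.range_zero, Finset.prod_empty, mul_one, ENNReal.ofReal_one] at h1
    have hS : MeasurableSet {ω | ∀ i ≤ 0, ξ i ω = 0} := by
      have : {ω | ∀ i ≤ 0, ξ i ω = 0} = ξ 0 ⁻¹' {0} := by ext ω; simp
      rw [this]; exact hw.2.1 0 (measurableSet_singleton 0)
    have h2 : ∀ᵐ ω ∂ℙ, ∀ i ≤ 0, ξ i ω = 0 := (prob_compl_eq_zero_iff hS).2 h1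
    have h3 : ∫ ω, φ (pt α x (ξ 0 ω)) ∂ℙ = ∫ _ω, φ x ∂ℙ := by
      apply integral_congr_ae
      filter_upwards [h2] with ω hω
      rw [hω 0 le_rfl]; simp [pt]
    rw [h3]; simp
  | succ n ih =>
    intro φ hφ
    rw [walk_int p hp h01 α x ℙ ξ hw n φ hφ, ih _ (Aop_cont p hp α φ hφ),
      Function.iterate_succ_apply]

theorem walk_lim (α : ℝ) (hα : Irrational α) (f : UnitAddCircle → ℝ)
    (hf : ZeroMeanBV f) (μs : Measure UnitAddCircle)
    (hμ : IsUniqueStationary (pOf f) α μs) (x : UnitAddCircle) (Ω : Type) [MeasurableSpace Ω]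
    (ℙ : Measure Ω) (ξ : ℕ → Ω → ℤ) (hw : IsQPWalk (pOf f) α x 0 ℙ ξ) (φ : C(UnitAddCircle, ℝ)) :
    Tendsto (fun n => ∫ ω, φ (pt α x (ξ n ω)) ∂ℙ) atTop (nhds (∫ z, φ z ∂μs)) := by
  have hP := hw.1
  have hc := hf.1
  obtain ⟨d, hd, hdp⟩ := pOf_ell f hc
  have h01 : ∀ z, 0 ≤ pOf f z ∧ pOf f z ≤ 1 :=
    fun z => ⟨by linarith [(hdp z).1], by linarith [(hdp z).2]⟩
  have hm : ∀ n, Measurable fun ω => pt α x (ξ n ω) := fun n => pt_meas α x _ (hw.2.1 n)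
  have hmap : ∀ n, ∀ ψ : UnitAddCircle → ℝ, Continuous ψ →
      ∫ z, ψ z ∂(ℙ.map fun ω => pt α x (ξ n ω)) = ∫ ω, ψ (pt α x (ξ n ω)) ∂ℙ := fun n ψ hψ =>
    integral_map (hm n).aemeasurable hψ.aestronglyMeasurable
  have := qp_main α hα f hf μs hμ x (fun n => ℙ.map fun ω => pt α x (ξ n ω))
    (fun n => Measure.isProbabilityMeasure_map (hm n).aemeasurable)
    (fun n ψ hψ => by
      rw [hmap n ψ hψ, walk_iter _ (pOf_cont f hc) h01 α x ℙ ξ hw n ψ hψ]) φ φ.continuous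
  simpa only [hmap _ φ φ.continuous] using this

/-- Proposition 2: if `𝔣` is continuous of bounded variation with
`∫_𝕋 𝔣 = 0`, `μ⋆` is the unique stationary measure, and the triple `(𝔭, α, x)`
satisfies condition (1.6) (`ℙ_x(max_{j≤n} ξ_j = ξ_n) → 0` and
`ℙ_x(min_{j≤n} ξ_j = ξ_n) → 0`), then `E φ(X_n^x) → ∫_𝕋 φ dμ⋆` for every continuous
`φ`. Consequently, if (1.6) holds for every `x ∈ 𝕋`, the random walk is mixing. -/
theorem statement3 (α : ℝ) (hα : Irrational α) (𝔣 : UnitAddCircle → ℝ)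
    (h𝔣 : ZeroMeanBV 𝔣) (μstar : Measure UnitAddCircle)
    (hμ : IsUniqueStationary (pOf 𝔣) α μstar) :
    (∀ (x : UnitAddCircle) (Ω : Type) [MeasurableSpace Ω] (ℙ : Measure Ω)
      (ξ : ℕ → Ω → ℤ), IsQPWalk (pOf 𝔣) α x 0 ℙ ξ → MaxMinCond ℙ ξ →
      ∀ φ : C(UnitAddCircle, ℝ),
        Tendsto (fun n => ∫ ω, φ (pt α x (ξ n ω)) ∂ℙ) atTop
          (nhds (∫ z, φ z ∂μstar))) ∧
    ((∀ (x : UnitAddCircle) (Ω : Type) [MeasurableSpace Ω] (ℙ : Measure Ω)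
      (ξ : ℕ → Ω → ℤ), IsQPWalk (pOf 𝔣) α x 0 ℙ ξ → MaxMinCond ℙ ξ) →
      Mixing (pOf 𝔣) α) := by
  exact ⟨fun x Ω _ ℙ ξ hw _ φ => walk_lim α hα 𝔣 h𝔣 μstar hμ x Ω ℙ ξ hw φ,
    fun _ => ⟨μstar, hμ.1, fun x Ω _ ℙ ξ hw φ => walk_lim α hα 𝔣 h𝔣 μstar hμ x Ω ℙ ξ hw φ⟩⟩
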